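/- Let M be a compact, connected, Hausdorff topological n-manifold, let S ⊆ M be a closed subset, and let x, y ∈ M ∖ S lie in different connected components of M ∖ S. Suppose h : S → M is a continuous map for which there exists a continuous homotopy H : [0,1] × S → M with H(0,s) = s for all s ∈ S, H(1,s) = h(s) for all s ∈ S, and H(t,s) ∉ {x,y} for all (t,s) ∈ [0,1] × S. Then the image h(S) is a closed subset of M not containing x or y, and x and y lie in different connected components of M ∖ h(S). -/

import Mathlib

open Metric MeasureTheory

/-- `M` is a topological `n`-manifold: every point has an open neighborhood
homeomorphic to an open subset of `ℝⁿ`. -/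
def IsTopManifold (n : ℕ) (M : Type*) [TopologicalSpace M] : Prop :=
  ∀ x : M, ∃ (U : Set M) (V : Set (EuclideanSpace ℝ (Fin n))),
    IsOpen U ∧ x ∈ U ∧ IsOpen V ∧ Nonempty (U ≃ₜ V)

namespace AlexanderSpanier

open Set Topology

/-- Mod 2 cochains of all degrees on `X`: functions on finite tuples of points. -/
abbrev Cochain (X : Type*) := List X → ZMod 2

variable {X Y : Type*}

/-- The underlying function of the mod 2 coboundary, which sums over all ways of omitting one
entry of a tuple. -/
def coboundaryFun : Cochain X → Cochain X
  | _, [] => 0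
  | ω, a :: l => ω l + coboundaryFun (fun m => ω (a :: m)) l

lemma coboundaryFun_add (ω η : Cochain X) (l : List X) :
    coboundaryFun (ω + η) l = coboundaryFun ω l + coboundaryFun η l := by
  induction l generalizing ω η with
  | nil => simp [coboundaryFun]
  | cons a l ih =>
    have := ih (fun m => ω (a :: m)) (fun m => η (a :: m))
    simp only [coboundaryFun, Pi.add_apply] at this ⊢
    rw [show (fun m => ω (a :: m) + η (a :: m)) =
      (fun m => ω (a :: m)) + (fun m => η (a :: m)) from rfl, this]
    ring

lemma coboundaryFun_smul (c : ZMod 2) (ω : Cochain X) (l : List X) :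
    coboundaryFun (c • ω) l = c * coboundaryFun ω l := by
  induction l generalizing ω with
  | nil => simp [coboundaryFun]
  | cons a l ih =>
    have := ih (fun m => ω (a :: m))
    simp only [coboundaryFun, Pi.smul_apply, smul_eq_mul] at this ⊢
    rw [show (fun m => c * ω (a :: m)) = c • (fun m => ω (a :: m)) from rfl, this]
    ring

/-- The mod 2 coboundary. -/
def d : Cochain X →ₗ[ZMod 2] Cochain X where
  toFun := coboundaryFun
  map_add' ω η := funext fun l => coboundaryFun_add ω η l
  map_smul' c ω := funext fun l => coboundaryFun_smul c ω l

@[simp] lemma d_nil (ω : Cochain X) : d ω [] = 0 := rfl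

lemma d_cons (ω : Cochain X) (a : X) (l : List X) :
    d ω (a :: l) = ω l + d (fun m => ω (a :: m)) l := rfl

lemma d_comp_add (ω η : Cochain X) (l : List X) :
    d (fun m => ω m + η m) l = d ω l + d η l := congrFun (d.map_add ω η) l

lemma d_const_mul (c : ZMod 2) (ω : Cochain X) (l : List X) :
    d (fun m => c * ω m) l = c * d ω l := congrFun (d.map_smul c ω) l

lemma d_d (ω : Cochain X) : d (d ω) = 0 := by
  ext l
  induction l generalizing ω with
  | nil => rfl
  | cons a l ih =>
    have := ih (fun m => ω (a :: m))
    simp only [d_cons, d_comp_add, Pi.zero_apply] at this ⊢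
    rw [this, add_zero, CharTwo.add_self_eq_zero]

/-- Pullback of cochains. -/
def pull (f : X → Y) : Cochain Y →ₗ[ZMod 2] Cochain X where
  toFun ω l := ω (l.map f)
  map_add' _ _ := rfl
  map_smul' _ _ := rfl

lemma pull_apply (f : X → Y) (ω : Cochain Y) (l : List X) : pull f ω l = ω (l.map f) := rfl

lemma d_pull (f : X → Y) (ω : Cochain Y) : d (pull f ω) = pull f (d ω) := by
  ext l
  induction l generalizing ω with
  | nil => rfl
  | cons a l ih => exact congrArg (ω (l.map f) + ·) (ih fun m => ω (f a :: m))

/-- The underlying function of the prism operator. -/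
def prismFun (f g : X → Y) : Cochain Y → Cochain X
  | _, [] => 0
  | ω, a :: l => ω (f a :: g a :: l.map g) + prismFun f g (fun m => ω (f a :: m)) l

lemma prismFun_add (f g : X → Y) (ω η : Cochain Y) (l : List X) :
    prismFun f g (ω + η) l = prismFun f g ω l + prismFun f g η l := by
  induction l generalizing ω η with
  | nil => simp [prismFun]
  | cons a l ih =>
    have := ih (fun m => ω (f a :: m)) (fun m => η (f a :: m))
    simp only [prismFun, Pi.add_apply] at this ⊢
    rw [show (fun m => ω (f a :: m) + η (f a :: m)) =
      (fun m => ω (f a :: m)) + (fun m => η (f a :: m)) from rfl, this]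
    ring

lemma d_prismFun (f g : X → Y) (ω : Cochain Y) (l : List X) :
    d (prismFun f g ω) l + prismFun f g (d ω) l = ω (l.map f) + ω (l.map g) := by
  induction l generalizing ω with
  | nil => simp [prismFun, CharTwo.add_self_eq_zero]
  | cons a l ih =>
    have h1 := ih fun m => ω (f a :: m)
    have h2 := congrFun (d_pull g fun m => ω (f a :: g a :: m)) l
    have h3 : prismFun f g (fun m => d ω (f a :: m)) l =
        prismFun f g ω l + prismFun f g (d fun m => ω (f a :: m)) l :=
      prismFun_add f g ω (d fun m => ω (f a :: m)) l
    have h4 : d (fun m => prismFun f g ω (a :: m)) l =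
        d (pull g fun m => ω (f a :: g a :: m)) l
          + d (prismFun f g fun m => ω (f a :: m)) l :=
      d_comp_add (pull g fun m => ω (f a :: g a :: m)) _ l
    have h5 : pull g (d fun m => ω (f a :: g a :: m)) l =
      d (fun m => ω (f a :: g a :: m)) (l.map g) := rfl
    rw [d_cons, h4, prismFun, h3, h2, h5]
    simp only [d_cons, List.map_cons] at h1 ⊢
    grind

lemma prismFun_eq_zero {f g : X → Y} {ω : Cochain Y} {W : Set Y} {l : List X}
    (hω : ∀ m : List Y, (∀ q ∈ m, q ∈ W) → ω m = 0) (hf : ∀ q ∈ l, f q ∈ W)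
    (hg : ∀ q ∈ l, g q ∈ W) : prismFun f g ω l = 0 := by
  induction l generalizing ω with
  | nil => rfl
  | cons a l ih =>
    simp only [List.mem_cons, forall_eq_or_imp] at hf hg
    rw [prismFun, hω, ih _ hf.2 hg.2, add_zero]
    · intro m hm
      exact hω _ (by simpa using ⟨hf.1, hm⟩)
    · simpa using ⟨hf.1, hg⟩

/-- Multiplication by a function of the first entry of a tuple. -/
def mulHead (a : X → ZMod 2) : Cochain X →ₗ[ZMod 2] Cochain X where
  toFun ω l := match l with
    | [] => 0
    | p :: m => a p * ω (p :: m)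
  map_add' ω η := by
    ext l; cases l <;> simp [mul_add]
  map_smul' c ω := by
    ext l; cases l <;> simp [mul_left_comm]

@[simp] lemma mulHead_nil (a : X → ZMod 2) (ω : Cochain X) : mulHead a ω [] = 0 := rfl
@[simp] lemma mulHead_cons (a : X → ZMod 2) (ω : Cochain X) (p : X) (l : List X) :
    mulHead a ω (p :: l) = a p * ω (p :: l) := rfl

/-- Cup product with the coboundary of a function. -/
def cupD (a : X → ZMod 2) : Cochain X →ₗ[ZMod 2] Cochain X where
  toFun ω l := match l with
    | p :: q :: m => (a p + a q) * ω (q :: m)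
    | _ => 0
  map_add' ω η := by
    ext l
    rcases l with _ | ⟨p, _ | ⟨q, l⟩⟩ <;> simp [mul_add]
  map_smul' c ω := by
    ext l
    rcases l with _ | ⟨p, _ | ⟨q, l⟩⟩ <;> simp [mul_left_comm]

@[simp] lemma cupD_nil (a : X → ZMod 2) (ω : Cochain X) : cupD a ω [] = 0 := rfl
@[simp] lemma cupD_singleton (a : X → ZMod 2) (ω : Cochain X) (p : X) : cupD a ω [p] = 0 := rfl
@[simp] lemma cupD_cons_cons (a : X → ZMod 2) (ω : Cochain X) (p q : X) (l : List X) :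
    cupD a ω (p :: q :: l) = (a p + a q) * ω (q :: l) := rfl

lemma d_mulHead (a : X → ZMod 2) {ω : Cochain X} (hω : ω [] = 0) :
    d (mulHead a ω) = cupD a ω + mulHead a (d ω) := by
  ext l
  rcases l with _ | ⟨p, _ | ⟨q, l⟩⟩
  · simp
  · simp [d_cons, hω]
  · have := d_const_mul (a p) (fun m => ω (p :: m)) (q :: l)
    rw [d_cons]
    simp only [mulHead_cons, this, Pi.add_apply, cupD_cons_cons, d_cons ω]
    grind

lemma d_cupD (a : X → ZMod 2) {ω : Cochain X} (hω : ω [] = 0) :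
    d (cupD a ω) = cupD a (d ω) := by
  have h := d_d (mulHead a ω)
  rw [d_mulHead a hω, map_add, d_mulHead a (d_nil ω), d_d, map_zero, add_zero] at h
  rw [← sub_eq_zero, ZModModule.sub_eq_add, h]

/-- `ω` is concentrated on nonempty tuples with `m` entries. -/
def HasLen (m : ℕ) (ω : Cochain X) : Prop := ∀ l, ω l ≠ 0 → l ≠ [] ∧ l.length = m

lemma HasLen.nil {m : ℕ} {ω : Cochain X} (h : HasLen m ω) : ω [] = 0 := by
  by_contra h0
  exact (h _ h0).1 rfl

lemma HasLen.add {m : ℕ} {ω η : Cochain X} (h : HasLen m ω) (h' : HasLen m η) :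
    HasLen m (ω + η) := by
  intro l hl
  by_cases h0 : ω l = 0
  · exact h' l (by simpa [h0] using hl)
  · exact h l h0

lemma HasLen.zero (m : ℕ) : HasLen m (0 : Cochain X) := fun _ hl => absurd rfl hl

lemma HasLen.smul {m : ℕ} {ω : Cochain X} (c : ZMod 2) (h : HasLen m ω) :
    HasLen m (c • ω) := fun l hl => h l fun h0 => hl (by simp [h0])

lemma HasLen.pull {m : ℕ} {ω : Cochain Y} (h : HasLen m ω) (f : X → Y) :
    HasLen m (pull f ω) := fun _ hl => by simpa using h _ hl

lemma HasLen.mulHead {m : ℕ} {ω : Cochain X} (h : HasLen m ω) (a : X → ZMod 2) :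
    HasLen m (mulHead a ω) := by
  intro l hl
  cases l with
  | nil => simp at hl
  | cons p l => exact h _ (right_ne_zero_of_mul hl)

lemma HasLen.cupD {m : ℕ} {ω : Cochain X} (h : HasLen m ω) (a : X → ZMod 2) :
    HasLen (m + 1) (cupD a ω) := by
  intro l hl
  rcases l with _ | ⟨p, _ | ⟨q, l⟩⟩
  · simp at hl
  · simp at hl
  · simpa using (h _ (right_ne_zero_of_mul hl)).2

lemma d_eq_zero_of_length {k : ℕ} {ω : Cochain X} (h : ∀ l, ω l ≠ 0 → l.length = k)
    {l : List X} (hl : d ω l ≠ 0) : l.length = k + 1 := by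
  induction l generalizing ω k with
  | nil => simp at hl
  | cons a l ih =>
    rw [d_cons] at hl
    by_cases h0 : ω l = 0
    · rw [h0, zero_add] at hl
      have hk : ∀ m, ω (a :: m) ≠ 0 → m.length = k - 1 := fun m hm => by
        have := h _ hm
        simp only [List.length_cons] at this
        omega
      have h1 := ih hk hl
      rcases k with _ | k
      · exfalso
        refine hl ?_
        rw [show (fun m => ω (a :: m)) = 0 from ?_]
        · simp
        · ext m
          by_contra hm
          simpa using h _ hm
      · simpa using h1
    · simpa using h _ h0

lemma HasLen.d {m : ℕ} {ω : Cochain X} (h : HasLen m ω) : HasLen (m + 1) (d ω) := by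
  intro l hl
  refine ⟨fun h0 => hl (by simp [h0]), d_eq_zero_of_length (fun l hl => (h l hl).2) hl⟩

lemma prismFun_length {k : ℕ} {f g : X → Y} {ω : Cochain Y}
    (h : ∀ l, ω l ≠ 0 → l.length = k) {l : List X}
    (hl : prismFun f g ω l ≠ 0) : l ≠ [] ∧ l.length + 1 = k := by
  induction l generalizing ω k with
  | nil => simp [prismFun] at hl
  | cons a l ih =>
    refine ⟨by simp, ?_⟩
    rw [prismFun] at hl
    by_cases h0 : ω (f a :: g a :: l.map g) = 0
    · rw [h0, zero_add] at hl
      have hk : ∀ m, ω (f a :: m) ≠ 0 → m.length = k - 1 := fun m hm => by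
        have := h _ hm
        simp only [List.length_cons] at this
        omega
      have h1 := (ih hk hl).2
      simp only [List.length_cons]
      omega
    · simpa using h _ h0

lemma HasLen.prismFun {m : ℕ} {ω : Cochain Y} (h : HasLen (m + 1) ω) (f g : X → Y) :
    HasLen m (prismFun f g ω) := fun l hl => by
  simpa using prismFun_length (fun l hl => (h l hl).2) hl

open Classical in
/-- Restriction of a cochain to tuples of points of `D`, extended by zero. -/
noncomputable def cut (D : Set X) (ω : Cochain X) : Cochain X :=
  fun l => if ∀ q ∈ l, q ∈ D then ω l else 0

lemma HasLen.cut {m : ℕ} {ω : Cochain X} (h : HasLen m ω) (D : Set X) :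
    HasLen m (cut D ω) := by
  intro l hl
  unfold AlexanderSpanier.cut at hl
  split_ifs at hl
  · exact h _ hl
  · simp at hl

lemma d_eq_zero_of_mem {ω : Cochain X} {N : Set X} (h : ∀ l : List X, (∀ q ∈ l, q ∈ N) → ω l = 0)
    {l : List X} (hl : ∀ q ∈ l, q ∈ N) : d ω l = 0 := by
  induction l generalizing ω with
  | nil => rfl
  | cons a l ih =>
    simp only [List.mem_cons, forall_eq_or_imp] at hl
    rw [d_cons, h l hl.2, ih _ hl.2, add_zero]
    exact fun m hm => h _ (by simpa using ⟨hl.1, hm⟩)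

/-- Modulo a submodule of cochains, being equal to a common third cochain is transitive. -/
lemma add_mem_of_add_mem {B : Submodule (ZMod 2) (Cochain X)} {ω η θ : Cochain X}
    (h : ω + θ ∈ B) (h' : η + θ ∈ B) : ω + η ∈ B := by
  have := B.add_mem h h'
  rwa [add_add_add_comm, ZModModule.add_self, add_zero] at this

section LocZero

variable [TopologicalSpace X] [TopologicalSpace Y]

/-- `ω` vanishes on all tuples of points sufficiently close to `p`. -/
def LocZero (ω : Cochain X) (p : X) : Prop := ∃ N ∈ 𝓝 p, ∀ l : List X, (∀ q ∈ l, q ∈ N) → ω l = 0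

variable {ω η : Cochain X} {p : X} {m : ℕ}

lemma LocZero.add (h : LocZero ω p) (h' : LocZero η p) : LocZero (ω + η) p := by
  obtain ⟨N, hN, h⟩ := h
  obtain ⟨N', hN', h'⟩ := h'
  exact ⟨N ∩ N', Filter.inter_mem hN hN', fun l hl => by
    simp [h l fun q hq => (hl q hq).1, h' l fun q hq => (hl q hq).2]⟩

lemma LocZero.zero (p : X) : LocZero 0 p := ⟨univ, Filter.univ_mem, fun _ _ => rfl⟩

lemma LocZero.smul (c : ZMod 2) (h : LocZero ω p) : LocZero (c • ω) p := by
  obtain ⟨N, hN, h⟩ := h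
  exact ⟨N, hN, fun l hl => by simp [h l hl]⟩

lemma LocZero.of_add (h : LocZero (ω + η) p) (h' : LocZero ω p) : LocZero η p := by
  simpa [← add_assoc, ZModModule.add_self] using h'.add h

lemma LocZero.of_add' (h : LocZero (ω + η) p) (h' : LocZero η p) : LocZero ω p :=
  LocZero.of_add (add_comm ω η ▸ h) h'

lemma LocZero.trans {θ : Cochain X} (h : LocZero (ω + η) p) (h' : LocZero (η + θ) p) :
    LocZero (ω + θ) p := by
  have := h.add h'
  rwa [show ω + η + (η + θ) = ω + θ + (η + η) by abel, ZModModule.add_self, add_zero] at this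

lemma LocZero.of_eq {N : Set X} (hN : N ∈ 𝓝 p)
    (he : ∀ l : List X, (∀ q ∈ l, q ∈ N) → ω l = η l) : LocZero (ω + η) p :=
  ⟨N, hN, fun l hl => by simp [he l hl, CharTwo.add_self_eq_zero]⟩

lemma LocZero.d (h : LocZero ω p) : LocZero (d ω) p := by
  obtain ⟨N, hN, h⟩ := h
  exact ⟨N, hN, fun l hl => d_eq_zero_of_mem h hl⟩

lemma LocZero.pull {f : X → Y} {ω : Cochain Y} (hf : ContinuousAt f p)
    (h : LocZero ω (f p)) : LocZero (pull f ω) p := by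
  obtain ⟨N, hN, h⟩ := h
  exact ⟨f ⁻¹' N, hf hN, fun l hl => h _ (by simpa using hl)⟩

lemma LocZero.mulHead (h : LocZero ω p) (a : X → ZMod 2) : LocZero (mulHead a ω) p := by
  obtain ⟨N, hN, h⟩ := h
  refine ⟨N, hN, fun l hl => ?_⟩
  cases l with
  | nil => rfl
  | cons q l => rw [mulHead_cons, h _ hl, mul_zero]

lemma LocZero.cupD (h : LocZero ω p) (a : X → ZMod 2) : LocZero (cupD a ω) p := by
  obtain ⟨N, hN, h⟩ := h
  refine ⟨N, hN, fun l hl => ?_⟩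
  rcases l with _ | ⟨q, _ | ⟨r, l⟩⟩
  · rfl
  · rfl
  · rw [cupD_cons_cons, h _ fun s hs => hl s (List.mem_cons_of_mem _ hs), mul_zero]

lemma locZero_mulHead_of_eq_zero {a : X → ZMod 2} (ha : ∀ᶠ q in 𝓝 p, a q = 0) :
    LocZero (mulHead a ω) p := by
  refine ⟨_, ha, fun l hl => ?_⟩
  cases l with
  | nil => rfl
  | cons q l => rw [mulHead_cons, show a q = 0 from hl q (by simp), zero_mul]

lemma locZero_mulHead_add_self {a : X → ZMod 2} (h0 : ω [] = 0) (ha : ∀ᶠ q in 𝓝 p, a q = 1) :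
    LocZero (mulHead a ω + ω) p := by
  refine LocZero.of_eq ha fun l hl => ?_
  cases l with
  | nil => exact h0.symm
  | cons q l => rw [mulHead_cons, show a q = 1 from hl q (by simp), one_mul]

lemma locZero_cupD_of_const {a : X → ZMod 2} {c : ZMod 2} (ha : ∀ᶠ q in 𝓝 p, a q = c) :
    LocZero (cupD a ω) p := by
  refine ⟨_, ha, fun l hl => ?_⟩
  rcases l with _ | ⟨q, _ | ⟨r, l⟩⟩
  · rfl
  · rfl
  · rw [cupD_cons_cons, show a q = c from hl q (by simp), show a r = c from hl r (by simp),
      CharTwo.add_self_eq_zero, zero_mul]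

lemma locZero_cut_add_self {D : Set X} (hp : D ∈ 𝓝 p) : LocZero (cut D ω + ω) p :=
  LocZero.of_eq hp fun _ hl => if_pos hl

lemma LocZero.cut (h : LocZero ω p) (D : Set X) : LocZero (cut D ω) p := by
  obtain ⟨N, hN, h⟩ := h
  refine ⟨N, hN, fun l hl => ?_⟩
  unfold AlexanderSpanier.cut
  split_ifs
  exacts [h l hl, rfl]

lemma locZero_cut_of_notMem {D : Set X} (hD : IsClosed D) (h0 : ω [] = 0) (hp : p ∉ D) :
    LocZero (cut D ω) p := by
  refine ⟨Dᶜ, hD.isOpen_compl.mem_nhds hp, fun l hl => ?_⟩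
  rcases l with _ | ⟨q, l⟩
  · simp [AlexanderSpanier.cut, h0]
  · exact if_neg fun h => hl q (by simp) (h q (by simp))

lemma locZero_prismFun {f g : X → Y} {ω : Cochain Y} (hf : ContinuousAt f p)
    (hg : ContinuousAt g p) (hfg : f p = g p) (h : LocZero ω (f p)) :
    LocZero (prismFun f g ω) p := by
  obtain ⟨N, hN, h⟩ := h
  exact ⟨f ⁻¹' N ∩ g ⁻¹' N, Filter.inter_mem (hf hN) (hg (hfg ▸ hN)), fun l hl =>
    prismFun_eq_zero h (fun q hq => (hl q hq).1) fun q hq => (hl q hq).2⟩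

/-- Chain homotopy between the pullbacks along the two ends of a homotopy. -/
lemma exists_homotopy {T : Type*} [TopologicalSpace T] [PreconnectedSpace T] {F : T × X → Y}
    (hF : Continuous F) {L : Set X} (hL : IsCompact L) {O : Set Y} (hO : IsOpen O)
    {ω : Cochain Y} (hω : HasLen (m + 1) ω) (hd : ∀ t, ∀ p ∈ L, LocZero (d ω) (F (t, p)))
    (hsupp : ∀ t, ∀ p ∈ L, F (t, p) ∉ O → LocZero ω (F (t, p))) (s t : T) :
    ∃ ζ : Cochain X, HasLen m ζ ∧
      (∀ p ∈ L, LocZero (pull (fun q => F (s, q)) ω + pull (fun q => F (t, q)) ω + d ζ) p) ∧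
      ∀ p ∈ L, (∀ r, F (r, p) ∉ O) → LocZero ζ p := by
  have key := (isPreconnected_univ (α := T)).induction₂ (fun s t => ∃ ζ : Cochain X, HasLen m ζ ∧
      (∀ p ∈ L, LocZero (pull (fun q => F (s, q)) ω + pull (fun q => F (t, q)) ω + d ζ) p) ∧
      ∀ p ∈ L, (∀ r, F (r, p) ∉ O) → LocZero ζ p) ?_ ?_ ?_ (mem_univ s) (mem_univ t)
  · exact key
  · intro t₀ _
    rw [nhdsWithin_univ]
    have hev : ∀ᶠ t in 𝓝 t₀, ∀ p ∈ L, ∃ N ∈ 𝓝 p, ∃ W : Set Y,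
        (∀ q ∈ N, F (t₀, q) ∈ W ∧ F (t, q) ∈ W) ∧
        (∀ l : List Y, (∀ q ∈ l, q ∈ W) → d ω l = 0) ∧
        ((∀ l : List Y, (∀ q ∈ l, q ∈ W) → ω l = 0) ∨ W ⊆ O) := by
      refine hL.eventually_forall_of_forall_eventually fun p hp => ?_
      obtain ⟨W, hW, hWd, hWO⟩ : ∃ W ∈ 𝓝 (F (t₀, p)),
          (∀ l : List Y, (∀ q ∈ l, q ∈ W) → d ω l = 0) ∧
          ((∀ l : List Y, (∀ q ∈ l, q ∈ W) → ω l = 0) ∨ W ⊆ O) := by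
        obtain ⟨N, hN, h⟩ := hd t₀ p hp
        by_cases hpO : F (t₀, p) ∈ O
        · exact ⟨N ∩ O, Filter.inter_mem hN (hO.mem_nhds hpO),
            fun l hl => h l fun q hq => (hl q hq).1, Or.inr inter_subset_right⟩
        · obtain ⟨N', hN', h'⟩ := hsupp t₀ p hp hpO
          exact ⟨N', hN', fun l hl => d_eq_zero_of_mem h' hl, Or.inl h'⟩
      have h1 := hF.continuousAt.preimage_mem_nhds hW
      rw [nhds_prod_eq, Filter.mem_prod_iff] at h1
      obtain ⟨J, hJ, N, hN, hJN⟩ := h1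
      rw [nhds_prod_eq]
      filter_upwards [Filter.prod_mem_prod hJ (eventually_mem_nhds_iff.2 hN)] with z hz
      exact ⟨N, hz.2, W, fun q hq => ⟨hJN ⟨mem_of_mem_nhds hJ, hq⟩, hJN ⟨hz.1, hq⟩⟩, hWd, hWO⟩
    filter_upwards [hev] with t ht
    refine ⟨prismFun (fun q => F (t₀, q)) (fun q => F (t, q)) ω, hω.prismFun _ _, ?_, ?_⟩
    · intro p hp
      obtain ⟨N, hN, W, hNW, hWd, -⟩ := ht p hp
      refine ⟨N, hN, fun l hl => ?_⟩
      have h1 := d_prismFun (fun q => F (t₀, q)) (fun q => F (t, q)) ω l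
      rw [prismFun_eq_zero hWd (fun q hq => (hNW q (hl q hq)).1)
        fun q hq => (hNW q (hl q hq)).2, add_zero] at h1
      rw [Pi.add_apply, h1]
      exact CharTwo.add_self_eq_zero _
    · intro p hp hpO
      obtain ⟨N, hN, W, hNW, -, hWO⟩ := ht p hp
      rcases hWO with hW | hW
      · exact ⟨N, hN, fun l hl => prismFun_eq_zero hW (fun q hq => (hNW q (hl q hq)).1)
          fun q hq => (hNW q (hl q hq)).2⟩
      · exact absurd (hW (hNW p (mem_of_mem_nhds hN)).1) (hpO t₀)
  · rintro r s t - - - ⟨ζ, hζ, h1, h2⟩ ⟨ξ, hξ, h3, h4⟩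
    refine ⟨ζ + ξ, hζ.add hξ, fun p hp => ?_, fun p hp hpO => (h2 p hp hpO).add (h4 p hp hpO)⟩
    have := (h1 p hp).add (h3 p hp)
    rw [map_add]
    set a := pull (fun q => F (s, q)) ω
    rwa [show ∀ x y u v : Cochain X, x + a + u + (a + y + v) = x + y + (u + v) + (a + a) by
      intros; abel, ZModModule.add_self, add_zero] at this
  · rintro s t - - ⟨ζ, hζ, h1, h2⟩
    refine ⟨ζ, hζ, fun p hp => ?_, h2⟩
    rw [add_comm (pull _ ω)]
    exact h1 p hp

end LocZero

section Supported

variable [TopologicalSpace X]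

/-- `ω` vanishes locally outside a compact subset of `U`. -/
def SuppIn (U : Set X) (ω : Cochain X) : Prop :=
  ∃ K : Set X, IsCompact K ∧ K ⊆ U ∧ ∀ p ∉ K, LocZero ω p

variable {U V : Set X} {ω η : Cochain X} {m : ℕ}

lemma SuppIn.mono (hUV : U ⊆ V) (h : SuppIn U ω) : SuppIn V ω := by
  obtain ⟨K, hK, hKU, h⟩ := h
  exact ⟨K, hK, hKU.trans hUV, h⟩

lemma SuppIn.add (h : SuppIn U ω) (h' : SuppIn U η) : SuppIn U (ω + η) := by
  obtain ⟨K, hK, hKU, h⟩ := h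
  obtain ⟨K', hK', hKU', h'⟩ := h'
  refine ⟨K ∪ K', hK.union hK', union_subset hKU hKU', fun p hp => ?_⟩
  rw [mem_union, not_or] at hp
  exact (h p hp.1).add (h' p hp.2)

lemma SuppIn.zero : SuppIn U (0 : Cochain X) :=
  ⟨∅, isCompact_empty, empty_subset _, fun p _ => LocZero.zero p⟩

lemma SuppIn.smul (c : ZMod 2) (h : SuppIn U ω) : SuppIn U (c • ω) := by
  obtain ⟨K, hK, hKU, h⟩ := h
  exact ⟨K, hK, hKU, fun p hp => (h p hp).smul c⟩

lemma SuppIn.d (h : SuppIn U ω) : SuppIn U (d ω) := by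
  obtain ⟨K, hK, hKU, h⟩ := h
  exact ⟨K, hK, hKU, fun p hp => (h p hp).d⟩

/-- Alexander-Spanier cocycles on tuples of `m` points, with compact support in `U`. -/
def cocycles (m : ℕ) (U : Set X) : Submodule (ZMod 2) (Cochain X) where
  carrier := {ω | HasLen m ω ∧ (∀ p, LocZero (d ω) p) ∧ SuppIn U ω}
  add_mem' h h' := ⟨h.1.add h'.1, fun p => by rw [map_add]; exact (h.2.1 p).add (h'.2.1 p),
    h.2.2.add h'.2.2⟩
  zero_mem' := ⟨HasLen.zero m, fun p => by rw [map_zero]; exact LocZero.zero p, SuppIn.zero⟩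
  smul_mem' c _ h := ⟨h.1.smul c, fun p => by rw [map_smul]; exact (h.2.1 p).smul c,
    h.2.2.smul c⟩

/-- Cochains which are locally the coboundary of a cochain on tuples of `m` points with compact
support in `U`. -/
def coboundaries (m : ℕ) (U : Set X) : Submodule (ZMod 2) (Cochain X) where
  carrier := {ω | ∃ η, HasLen m η ∧ SuppIn U η ∧ ∀ p, LocZero (ω + d η) p}
  add_mem' := by
    rintro ω ω' ⟨η, h1, h2, h3⟩ ⟨η', h1', h2', h3'⟩
    refine ⟨η + η', h1.add h1', h2.add h2', fun p => ?_⟩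
    rw [map_add, add_add_add_comm]
    exact (h3 p).add (h3' p)
  zero_mem' := ⟨0, HasLen.zero m, SuppIn.zero, fun p => by
    rw [map_zero, add_zero]; exact LocZero.zero p⟩
  smul_mem' := by
    rintro c ω ⟨η, h1, h2, h3⟩
    refine ⟨c • η, h1.smul c, h2.smul c, fun p => ?_⟩
    rw [map_smul, ← smul_add]
    exact (h3 p).smul c

lemma cocycles_mono (h : U ⊆ V) : cocycles m U ≤ cocycles m V :=
  fun _ hω => ⟨hω.1, hω.2.1, hω.2.2.mono h⟩

lemma coboundaries_mono (h : U ⊆ V) : coboundaries m U ≤ coboundaries m V := by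
  rintro ω ⟨η, h1, h2, h3⟩
  exact ⟨η, h1, h2.mono h, h3⟩

lemma d_mem_coboundaries (h : HasLen m ω) (h' : SuppIn U ω) : d ω ∈ coboundaries m U :=
  ⟨ω, h, h', fun p => by rw [ZModModule.add_self]; exact LocZero.zero p⟩

lemma mem_coboundaries_of_locZero (h : ∀ p, LocZero ω p) : ω ∈ coboundaries m U :=
  ⟨0, HasLen.zero m, SuppIn.zero, fun p => by simpa using h p⟩

end Supported

section MayerVietoris

variable [TopologicalSpace X] {U V : Set X} {ω η : Cochain X} {m n : ℕ}

lemma SuppIn.congr (h : SuppIn U ω) (he : ∀ p, LocZero (ω + η) p) : SuppIn U η := by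
  obtain ⟨K, hK, hKU, h⟩ := h
  exact ⟨K, hK, hKU, fun p hp => (he p).of_add (h p hp)⟩

lemma SuppIn.inter [T2Space X] (h : SuppIn U ω) (h' : SuppIn V ω) : SuppIn (U ∩ V) ω := by
  obtain ⟨K, hK, hKU, h⟩ := h
  obtain ⟨K', hK', hKU', h'⟩ := h'
  refine ⟨K ∩ K', hK.inter hK', inter_subset_inter hKU hKU', fun p hp => ?_⟩
  by_cases hpK : p ∈ K
  · exact h' p fun hpK' => hp ⟨hpK, hpK'⟩
  · exact h p hpK

lemma exists_split [T2Space X] [LocallyCompactSpace X] (hU : IsOpen U) (hV : IsOpen V)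
    (h0 : ω [] = 0) (hs : SuppIn (U ∪ V) ω) :
    ∃ a : X → ZMod 2, SuppIn U (mulHead a ω) ∧ SuppIn V (mulHead a ω + ω) ∧
      SuppIn (U ∩ V) (cupD a ω) := by
  classical
  obtain ⟨K, hK, hKU, h⟩ := hs
  obtain ⟨K₁, K₂, hK₁, hK₂, hKU₁, hKV₂, rfl⟩ := hK.binary_compact_cover hU hV hKU
  obtain ⟨L, hL, hKL, hLU⟩ := exists_compact_between hK₁ hU hKU₁
  have hout : ∀ p ∉ L, ∀ᶠ q in 𝓝 p, L.indicator (1 : X → ZMod 2) q = 0 := fun p hp => by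
    filter_upwards [hL.isClosed.isOpen_compl.mem_nhds hp] with q hq
    exact indicator_of_notMem hq _
  have hin : ∀ p ∈ K₁, ∀ᶠ q in 𝓝 p, L.indicator (1 : X → ZMod 2) q = 1 := fun p hp => by
    filter_upwards [mem_interior_iff_mem_nhds.1 (hKL hp)] with q hq
    exact indicator_of_mem hq _
  refine ⟨L.indicator 1, ⟨L, hL, hLU, fun p hp => locZero_mulHead_of_eq_zero (hout p hp)⟩,
    ⟨K₂, hK₂, hKV₂, fun p hp => ?_⟩,
    ⟨L ∩ K₂, hL.inter hK₂, inter_subset_inter hLU hKV₂, fun p hp => ?_⟩⟩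
  · by_cases hp1 : p ∈ K₁
    · exact locZero_mulHead_add_self h0 (hin p hp1)
    · have := h p (by simp [hp, hp1])
      exact (this.mulHead _).add this
  · by_cases hpL : p ∈ L
    · by_cases hp1 : p ∈ K₁
      · exact locZero_cupD_of_const (hin p hp1)
      · exact (h p fun hp' => hp'.elim hp1 fun h2 => hp ⟨hpL, h2⟩).cupD _
    · exact locZero_cupD_of_const (hout p hpL)

lemma cocycles_union_le [T2Space X] [LocallyCompactSpace X] (hU : IsOpen U) (hV : IsOpen V)
    (h : cocycles (m + 1) (U ∩ V) ≤ coboundaries m (U ∩ V)) :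
    cocycles m (U ∪ V) ≤ cocycles m U ⊔ cocycles m V := by
  intro ω hω
  obtain ⟨a, ha1, ha2, ha3⟩ := exists_split hU hV hω.1.nil hω.2.2
  obtain ⟨θ, hθ1, hθ2, hθ3⟩ := @h (cupD a ω) ⟨hω.1.cupD a, fun p => by
    rw [d_cupD a hω.1.nil]; exact (hω.2.1 p).cupD a, ha3⟩
  have hd : ∀ p, LocZero (d (mulHead a ω + θ)) p := fun p => by
    rw [map_add, d_mulHead a hω.1.nil, add_right_comm]
    exact (hθ3 p).add ((hω.2.1 p).mulHead a)
  refine Submodule.mem_sup.2 ⟨mulHead a ω + θ, ⟨(hω.1.mulHead a).add hθ1, hd,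
    ha1.add (hθ2.mono inter_subset_left)⟩, mulHead a ω + θ + ω,
    ⟨((hω.1.mulHead a).add hθ1).add hω.1, fun p => ?_, ?_⟩, ?_⟩
  · rw [map_add]
    exact (hd p).add (hω.2.1 p)
  · rw [add_right_comm]
    exact ha2.add (hθ2.mono inter_subset_right)
  · rw [← add_assoc, ZModModule.add_self, zero_add]

/-- Compactly supported cohomology of `U` vanishes above degree `n`, and is generated in degree
`n` by the classes of the cochains `g p` with `p ∈ U`. -/
def IsGenerated (n : ℕ) (g : X → Cochain X) (U : Set X) : Prop :=
  (∀ m, n < m → cocycles (m + 1) U ≤ coboundaries m U) ∧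
    cocycles (n + 1) U ≤ coboundaries n U ⊔ Submodule.span (ZMod 2) (g '' U)

variable {g : X → Cochain X}

lemma isGenerated_empty : IsGenerated n g (∅ : Set X) := by
  have h : ∀ k m, cocycles k (∅ : Set X) ≤ coboundaries m ∅ := by
    rintro k m ω ⟨-, -, K, -, hK, h⟩
    exact mem_coboundaries_of_locZero fun p => h p fun hp => hK hp
  exact ⟨fun m _ => h _ _, (h _ _).trans le_sup_left⟩

lemma IsGenerated.union [T2Space X] [LocallyCompactSpace X] (hU : IsOpen U) (hV : IsOpen V)
    (h₁ : IsGenerated n g U) (h₂ : IsGenerated n g V) (h : IsGenerated n g (U ∩ V)) :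
    IsGenerated n g (U ∪ V) := by
  refine ⟨fun m hm => ?_, ?_⟩
  · exact (cocycles_union_le hU hV (h.1 _ (by omega))).trans (sup_le
      ((h₁.1 m hm).trans (coboundaries_mono subset_union_left))
      ((h₂.1 m hm).trans (coboundaries_mono subset_union_right)))
  · exact (cocycles_union_le hU hV (h.1 _ (by omega))).trans (sup_le
      (h₁.2.trans (sup_le_sup (coboundaries_mono subset_union_left)
        (Submodule.span_mono (image_mono subset_union_left))))
      (h₂.2.trans (sup_le_sup (coboundaries_mono subset_union_right)
        (Submodule.span_mono (image_mono subset_union_right)))))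

/-- The union of a list of sets. -/
def listUnion (L : List (Set X)) : Set X := L.foldr (· ∪ ·) ∅

lemma mem_listUnion {Z : Type*} {L : List (Set Z)} {p : Z} : p ∈ listUnion L ↔ ∃ B ∈ L, p ∈ B := by
  induction L with
  | nil => simp [listUnion]
  | cons B L ih =>
    rw [show listUnion (B :: L) = B ∪ listUnion L from rfl, mem_union, ih]
    simp

lemma isOpen_listUnion {L : List (Set X)} (h : ∀ B ∈ L, IsOpen B) : IsOpen (listUnion L) := by
  induction L with
  | nil => exact isOpen_empty
  | cons B L ih =>
    exact (h B (by simp)).union (ih fun C hC => h C (List.mem_cons_of_mem _ hC))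

lemma isGenerated_listUnion [T2Space X] [LocallyCompactSpace X] {𝓑 : Set (Set X)}
    (hopen : ∀ B ∈ 𝓑, IsOpen B) (hinter : ∀ B ∈ 𝓑, ∀ C ∈ 𝓑, B ∩ C ∈ 𝓑)
    (hgen : ∀ B ∈ 𝓑, IsGenerated n g B) (L : List (Set X)) (hL : ∀ B ∈ L, B ∈ 𝓑) :
    IsGenerated n g (listUnion L) := by
  induction hk : L.length generalizing L with
  | zero =>
    rw [List.length_eq_zero_iff.1 hk]
    exact isGenerated_empty
  | succ k ih =>
    rcases L with _ | ⟨B, L⟩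
    · simp at hk
    · simp only [List.mem_cons, forall_eq_or_imp] at hL
      refine IsGenerated.union (hopen B hL.1) (isOpen_listUnion fun C hC => hopen C (hL.2 C hC))
        (hgen B hL.1) (ih L hL.2 (by simpa using hk)) ?_
      have h := ih (L.map (B ∩ ·)) (fun C hC => by
        obtain ⟨D, hD, rfl⟩ := List.mem_map.1 hC
        exact hinter B hL.1 D (hL.2 D hD)) (by simpa using hk)
      convert h using 1
      ext p
      simp only [mem_inter_iff]
      change p ∈ B ∧ p ∈ listUnion L ↔ _
      simp only [mem_listUnion, List.mem_map, exists_exists_and_eq_and, mem_inter_iff]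
      exact ⟨fun ⟨h1, C, hC, h2⟩ => ⟨C, hC, h1, h2⟩, fun ⟨C, hC, h1, h2⟩ => ⟨h1, C, hC, h2⟩⟩

lemma exists_list_of_isCompact {𝓑 : Set (Set X)} (hopen : ∀ B ∈ 𝓑, IsOpen B)
    (hU : ∀ p ∈ U, ∃ B ∈ 𝓑, p ∈ B ∧ B ⊆ U) {K : Set X} (hK : IsCompact K) (hKU : K ⊆ U) :
    ∃ L : List (Set X), (∀ B ∈ L, B ∈ 𝓑) ∧ K ⊆ listUnion L ∧ listUnion L ⊆ U := by
  choose! B hB hpB hBU using hU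
  obtain ⟨t, htK, hKt⟩ := hK.elim_nhds_subcover B fun p hp =>
    (hopen _ (hB p (hKU hp))).mem_nhds (hpB p (hKU hp))
  refine ⟨t.toList.map B, fun C hC => ?_, fun p hp => ?_, fun p hp => ?_⟩
  · obtain ⟨q, hq, rfl⟩ := List.mem_map.1 hC
    exact hB q (hKU (htK q (by simpa using hq)))
  · obtain ⟨q, hq, hpq⟩ := mem_iUnion₂.1 (hKt hp)
    exact mem_listUnion.2 ⟨B q, List.mem_map.2 ⟨q, by simpa using hq, rfl⟩, hpq⟩
  · obtain ⟨C, hC, hpC⟩ := mem_listUnion.1 hp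
    obtain ⟨q, hq, rfl⟩ := List.mem_map.1 hC
    exact hBU q (hKU (htK q (by simpa using hq))) hpC

lemma isGenerated_of_basis [T2Space X] [LocallyCompactSpace X] {𝓑 : Set (Set X)}
    (hopen : ∀ B ∈ 𝓑, IsOpen B) (hinter : ∀ B ∈ 𝓑, ∀ C ∈ 𝓑, B ∩ C ∈ 𝓑)
    (hgen : ∀ B ∈ 𝓑, IsGenerated n g B) (hU : ∀ p ∈ U, ∃ B ∈ 𝓑, p ∈ B ∧ B ⊆ U) :
    IsGenerated n g U := by
  have key : ∀ k, ∀ ω ∈ cocycles k U, ∃ V ⊆ U, IsGenerated n g V ∧ ω ∈ cocycles k V := by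
    rintro k ω ⟨h1, h2, K, hK, hKU, h3⟩
    obtain ⟨L, hL, hKL, hLU⟩ := exists_list_of_isCompact hopen hU hK hKU
    exact ⟨listUnion L, hLU, isGenerated_listUnion hopen hinter hgen L hL, h1, h2, K, hK, hKL, h3⟩
  refine ⟨fun m hm ω hω => ?_, fun ω hω => ?_⟩
  · obtain ⟨V, hVU, hV, hωV⟩ := key _ ω hω
    exact coboundaries_mono hVU (hV.1 m hm hωV)
  · obtain ⟨V, hVU, hV, hωV⟩ := key _ ω hω
    exact sup_le_sup (coboundaries_mono hVU) (Submodule.span_mono (image_mono hVU)) (hV.2 hωV)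

/-- A combination of the cochains `g p`, with `p ∈ U`, which is a coboundary on `U`
has an even number of terms. -/
def IsEven (n : ℕ) (g : X → Cochain X) (U : Set X) : Prop :=
  ∀ c ∈ Finsupp.supported (ZMod 2) (ZMod 2) U,
    Finsupp.linearCombination (ZMod 2) g c ∈ coboundaries n U →
      Finsupp.linearCombination (ZMod 2) (fun _ => (1 : ZMod 2)) c = 0

lemma linearCombination_mem_cocycles (hg : ∀ p, g p ∈ cocycles (n + 1) {p}) {c : X →₀ ZMod 2}
    (hc : c ∈ Finsupp.supported (ZMod 2) (ZMod 2) U) :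
    Finsupp.linearCombination (ZMod 2) g c ∈ cocycles (n + 1) U := by
  refine Submodule.sum_mem _ fun p hp => Submodule.smul_mem _ _ ?_
  exact cocycles_mono (singleton_subset_iff.2 ((Finsupp.mem_supported _ c).1 hc hp)) (hg p)

lemma IsEven.union [T2Space X] [LocallyCompactSpace X] (hg : ∀ p, g p ∈ cocycles (n + 1) {p})
    (hU : IsOpen U) (hV : IsOpen V) (h₁ : IsEven n g U) (h₂ : IsEven n g V)
    (h : IsGenerated n g (U ∩ V)) : IsEven n g (U ∪ V) := by
  classical
  rintro c hc ⟨η, hη1, hη2, hη3⟩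
  obtain ⟨a, ha1, ha2, -⟩ := exists_split hU hV hη1.nil hη2
  set c₁ := c.filter (· ∈ U) with hc₁
  set c₂ := c.filter (fun p => ¬ p ∈ U) with hc₂
  have hcc : c₁ + c₂ = c := Finsupp.filter_add_filter_not c _
  have hs₁ : c₁ ∈ Finsupp.supported (ZMod 2) (ZMod 2) U := by
    rw [Finsupp.mem_supported]
    intro p hp
    rw [hc₁, Finsupp.support_filter] at hp
    exact (Finset.mem_filter.1 hp).2
  have hs₂ : c₂ ∈ Finsupp.supported (ZMod 2) (ZMod 2) V := by
    rw [Finsupp.mem_supported]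
    intro p hp
    rw [hc₂, Finsupp.support_filter] at hp
    have hp := Finset.mem_filter.1 hp
    exact ((Finsupp.mem_supported _ c).1 hc hp.1).resolve_left hp.2
  set σ := Finsupp.linearCombination (ZMod 2) g
  have hσ₁ := linearCombination_mem_cocycles hg hs₁
  have hσ₂ := linearCombination_mem_cocycles hg hs₂
  have hθ : σ c₁ + d (mulHead a η) ∈ cocycles (n + 1) (U ∩ V) := by
    refine ⟨hσ₁.1.add (hη1.mulHead a).d, fun p => ?_, ?_⟩
    · rw [map_add, d_d, add_zero]
      exact hσ₁.2.1 p
    · refine (hσ₁.2.2.add ha1.d).inter ((hσ₂.2.2.add ha2.d).congr fun p => ?_)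
      convert hη3 p using 1
      rw [← hcc, map_add, map_add]
      rw [show ∀ x y u v : Cochain X, x + (u + v) + (y + u) = y + x + v + (u + u) by
        intros; abel, ZModModule.add_self, add_zero]
  obtain ⟨b, hb, e, he, hbe⟩ := Submodule.mem_sup.1 (h.2 hθ)
  obtain ⟨c₃, hs₃, rfl⟩ := (Finsupp.mem_span_image_iff_linearCombination _).1 he
  have hbe' : b + σ c₃ = σ c₁ + d (mulHead a η) := hbe
  have e₁ := h₁ (c₁ + c₃) (Submodule.add_mem _ hs₁
    (Finsupp.supported_mono inter_subset_left hs₃)) (by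
      rw [map_add]
      rw [show σ c₁ + σ c₃ = d (mulHead a η) + b from ?_]
      · exact Submodule.add_mem _ (d_mem_coboundaries (hη1.mulHead a) ha1)
          (coboundaries_mono inter_subset_left hb)
      · rw [← sub_eq_zero, ZModModule.sub_eq_add]
        calc _ = (b + σ c₃) + (σ c₁ + d (mulHead a η)) := by abel
          _ = 0 := by rw [hbe', ZModModule.add_self])
  have e₂ := h₂ (c₂ + c₃) (Submodule.add_mem _ hs₂
    (Finsupp.supported_mono inter_subset_right hs₃)) (by
      rw [map_add]
      rw [show σ c₂ + σ c₃ = (σ c + d η) + d (mulHead a η + η) + b from ?_]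
      · exact Submodule.add_mem _ (Submodule.add_mem _ (mem_coboundaries_of_locZero hη3)
          (d_mem_coboundaries ((hη1.mulHead a).add hη1) ha2))
          (coboundaries_mono inter_subset_right hb)
      · rw [← sub_eq_zero, ZModModule.sub_eq_add, ← hcc, map_add, map_add]
        calc _ = (b + σ c₃) + (σ c₁ + d (mulHead a η)) + ((σ c₂ + σ c₂) + (d η + d η)) := by abel
          _ = 0 := by simp only [hbe', ZModModule.add_self])
  have := congrArg₂ (· + ·) e₁ e₂
  simp only [map_add, add_zero] at this
  rw [← hcc, map_add]
  rw [← this]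
  rw [add_add_add_comm, ZModModule.add_self (Finsupp.linearCombination (ZMod 2) _ c₃), add_zero]

lemma isEven_listUnion [T2Space X] [LocallyCompactSpace X]
    (hg : ∀ p, g p ∈ cocycles (n + 1) {p}) (hgen : ∀ U : Set X, IsOpen U → IsGenerated n g U)
    (L : List (Set X)) (hL : ∀ B ∈ L, IsOpen B) (heven : ∀ B ∈ L, IsEven n g B) :
    IsEven n g (listUnion L) := by
  induction L with
  | nil =>
    intro c hc _
    have : c = 0 := by
      simpa [listUnion] using hc
    simp [this]
  | cons B L ih =>
    simp only [List.mem_cons, forall_eq_or_imp] at hL heven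
    exact IsEven.union hg hL.1 (isOpen_listUnion hL.2) heven.1 (ih hL.2 heven.2)
      (hgen _ (hL.1.inter (isOpen_listUnion hL.2)))

end MayerVietoris

section Cell

variable [TopologicalSpace X] {U V : Set X} {ω : Cochain X} {n : ℕ}

/-- An open set with the compactly supported mod 2 cohomology of `ℝⁿ` in degrees at least `n`,
whose generator can be supported at any prescribed point. -/
structure IsCell (n : ℕ) (U : Set X) : Prop where
  isOpen : IsOpen U
  vanish : ∀ m, n < m → cocycles (m + 1) U ≤ coboundaries m U
  exists_generator : ∀ p ∈ U, ∃ g ∈ cocycles (n + 1) {p}, g ∉ coboundaries n U ∧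
    ∀ ω ∈ cocycles (n + 1) U, ω ∈ coboundaries n U ∨ ω + g ∈ coboundaries n U

lemma IsCell.add_mem (hU : IsCell n U) (hne : U.Nonempty) {η : Cochain X}
    (hω : ω ∈ cocycles (n + 1) U) (hη : η ∈ cocycles (n + 1) U) (hω' : ω ∉ coboundaries n U)
    (hη' : η ∉ coboundaries n U) : ω + η ∈ coboundaries n U := by
  obtain ⟨p, hp⟩ := hne
  obtain ⟨g, -, -, hgen⟩ := hU.exists_generator p hp
  exact add_mem_of_add_mem ((hgen ω hω).resolve_left hω') ((hgen η hη).resolve_left hη')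

lemma IsCell.mem_coboundaries (hU : IsCell n U) (hV : IsCell n V) (hne : U.Nonempty)
    (hUV : U ⊆ V) (hω : ω ∈ cocycles (n + 1) U) (h : ω ∈ coboundaries n V) :
    ω ∈ coboundaries n U := by
  obtain ⟨p, hp⟩ := hne
  obtain ⟨g, hg, hgV, -⟩ := hV.exists_generator p (hUV hp)
  by_contra hωU
  have := coboundaries_mono hUV (hU.add_mem ⟨p, hp⟩ hω (cocycles_mono
    (singleton_subset_iff.2 hp) hg) hωU fun hgU => hgV (coboundaries_mono hUV hgU))
  exact hgV ((Submodule.add_mem_iff_right _ h).1 this)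

/-- A family of cocycles supported at points which represent the local generators. -/
def IsLocalGenerator (n : ℕ) (g : X → Cochain X) : Prop :=
  ∀ p, g p ∈ cocycles (n + 1) {p} ∧ ∃ U, IsCell n U ∧ p ∈ U ∧ g p ∉ coboundaries n U

variable {g : X → Cochain X}

lemma IsCell.notMem_coboundaries (hg : IsLocalGenerator n g)
    (hcell : ∀ p : X, ∀ U, IsOpen U → p ∈ U → ∃ V, IsCell n V ∧ p ∈ V ∧ V ⊆ U)
    (hU : IsCell n U) {p : X} (hp : p ∈ U) :
    g p ∉ coboundaries n U := by
  obtain ⟨hp1, V, hV, hpV, hgV⟩ := hg p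
  obtain ⟨W, hW, hpW, hWUV⟩ := hcell p (U ∩ V) (hU.isOpen.inter hV.isOpen) ⟨hp, hpV⟩
  intro h
  exact hgV (coboundaries_mono (hWUV.trans inter_subset_right) (hW.mem_coboundaries hU ⟨p, hpW⟩
    (hWUV.trans inter_subset_left) (cocycles_mono (singleton_subset_iff.2 hpW) hp1) h))

lemma IsCell.add_mem_coboundaries (hg : IsLocalGenerator n g)
    (hcell : ∀ p : X, ∀ U, IsOpen U → p ∈ U → ∃ V, IsCell n V ∧ p ∈ V ∧ V ⊆ U)
    (hU : IsCell n U) {p q : X} (hp : p ∈ U) (hq : q ∈ U) :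
    g p + g q ∈ coboundaries n U :=
  hU.add_mem ⟨p, hp⟩ (cocycles_mono (singleton_subset_iff.2 hp) (hg p).1)
    (cocycles_mono (singleton_subset_iff.2 hq) (hg q).1) (hU.notMem_coboundaries hg hcell hp)
    (hU.notMem_coboundaries hg hcell hq)

lemma IsCell.isGenerated (hg : IsLocalGenerator n g)
    (hcell : ∀ p : X, ∀ U, IsOpen U → p ∈ U → ∃ V, IsCell n V ∧ p ∈ V ∧ V ⊆ U)
    (hU : IsCell n U) : IsGenerated n g U := by
  refine ⟨hU.vanish, fun ω hω => ?_⟩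
  by_cases h : ω ∈ coboundaries n U
  · exact Submodule.mem_sup_left h
  · obtain ⟨p, hp⟩ : U.Nonempty := by
      rw [nonempty_iff_ne_empty]
      rintro rfl
      obtain ⟨K, -, hK, h0⟩ := hω.2.2
      exact h (mem_coboundaries_of_locZero fun p => h0 p fun hp => hK hp)
    have := hU.add_mem ⟨p, hp⟩ hω (cocycles_mono (singleton_subset_iff.2 hp) (hg p).1) h
      (hU.notMem_coboundaries hg hcell hp)
    refine Submodule.mem_sup.2 ⟨_, this, g p, Submodule.subset_span ⟨p, hp, rfl⟩, ?_⟩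
    rw [add_assoc, ZModModule.add_self, add_zero]

lemma IsCell.isEven (hg : IsLocalGenerator n g)
    (hcell : ∀ p : X, ∀ U, IsOpen U → p ∈ U → ∃ V, IsCell n V ∧ p ∈ V ∧ V ⊆ U)
    (hU : IsCell n U) : IsEven n g U := by
  intro c hc hcU
  by_cases hne : U.Nonempty
  · obtain ⟨p, hp⟩ := hne
    have h1 : Finsupp.linearCombination (ZMod 2) g c +
        (Finsupp.linearCombination (ZMod 2) (fun _ => (1 : ZMod 2)) c) • g p ∈
          coboundaries n U := by
      rw [Finsupp.linearCombination_apply, Finsupp.linearCombination_apply, Finsupp.sum,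
        Finsupp.sum, Finset.sum_smul, ← Finset.sum_add_distrib]
      refine Submodule.sum_mem _ fun q hq => ?_
      rw [smul_eq_mul, mul_one, ← smul_add]
      exact Submodule.smul_mem _ _
        (hU.add_mem_coboundaries hg hcell ((Finsupp.mem_supported _ c).1 hc hq) hp)
    have h2 := (Submodule.add_mem_iff_right _ hcU).1 h1
    by_contra h0
    exact hU.notMem_coboundaries hg hcell hp ((Submodule.smul_mem_iff _ h0).1 h2)
  · have : c = 0 := by
      simpa [not_nonempty_iff_eq_empty.1 hne] using hc
    simp [this]

end Cell

section Point

lemma d_apply_of_subsingleton [Subsingleton X] (ω : Cochain X) (l : List X) :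
    d ω l = l.length * ω l.tail := by
  induction l generalizing ω with
  | nil => simp
  | cons a l ih =>
    rw [d_cons, ih]
    cases l with
    | nil => simp
    | cons b l => simp [Subsingleton.elim b a, add_mul, add_comm]

variable [TopologicalSpace X] [Unique X]

lemma locZero_iff_of_unique {ω : Cochain X} {p : X} : LocZero ω p ↔ ω = 0 := by
  refine ⟨fun ⟨N, hN, h⟩ => funext fun l => h l fun q _ => ?_, fun h => h ▸ LocZero.zero p⟩
  rw [Subsingleton.elim q p]
  exact mem_of_mem_nhds hN

lemma suppIn_of_unique (ω : Cochain X) (p : X) : SuppIn {p} ω :=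
  ⟨{p}, isCompact_singleton, Subset.rfl, fun q hq => absurd (Subsingleton.elim q p) hq⟩

lemma isCell_of_unique : IsCell 0 (univ : Set X) := by
  classical
  have huniv : ∀ p : X, ({p} : Set X) = univ := fun p => eq_univ_of_forall fun q => Subsingleton.elim q p
  refine ⟨isOpen_univ, fun m hm ω hω => ?_, fun p _ => ?_⟩
  · have hd := locZero_iff_of_unique.1 (hω.2.1 default)
    refine ⟨fun l => if l.length = m then ω (default :: l) else 0, fun l hl => ?_,
      huniv default ▸ suppIn_of_unique _ _, fun p => locZero_iff_of_unique.2 ?_⟩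
    · have hlm : l.length = m := by
        by_contra h
        exact hl (if_neg h)
      refine ⟨?_, hlm⟩
      rintro rfl
      simp only [List.length_nil] at hlm
      omega
    · ext l
      have hdl := congrFun hd (default :: l)
      rw [d_apply_of_subsingleton] at hdl
      rw [Pi.add_apply, d_apply_of_subsingleton]
      rcases l with _ | ⟨q, l⟩
      · simp [hω.1.nil]
      · simp only [List.tail_cons, List.length_cons, Pi.zero_apply] at hdl ⊢
        by_cases hl : l.length = m
        · simp only [hl, if_true, Subsingleton.elim default q] at hdl ⊢
          push_cast at hdl ⊢
          linear_combination hdl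
        · have h0 : ω (q :: l) = 0 := by
            by_contra h0
            exact hl (by simpa using (hω.1 _ h0).2)
          simp [hl, h0]
  · set g : Cochain X := fun l => if l.length = 1 then 1 else 0 with hg
    have hlen : HasLen 1 g := fun l hl => by
      have hl1 : l.length = 1 := by
        by_contra h
        exact hl (if_neg h)
      refine ⟨?_, hl1⟩
      rintro rfl
      simp at hl1
    refine ⟨g, ⟨hlen, fun q => locZero_iff_of_unique.2 ?_, suppIn_of_unique g p⟩, ?_, ?_⟩
    · ext l
      rw [d_apply_of_subsingleton]
      rcases l with _ | ⟨q, _ | ⟨r, l⟩⟩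
      · simp
      · simp [hg]
      · rcases l with _ | ⟨s, l⟩
        · simp [hg]; rfl
        · simp [hg]
    · rintro ⟨η, h1, -, h3⟩
      have hη : η = 0 := by
        ext l
        by_contra h
        obtain ⟨h4, h5⟩ := h1 l h
        exact h4 (List.length_eq_zero_iff.1 h5)
      have := congrFun (locZero_iff_of_unique.1 (h3 p)) [p]
      simp [hη, hg] at this
    · rintro ω hω
      have hz : ∀ l, l.length ≠ 1 → ω l = 0 := fun l hl => by
        by_contra h
        exact hl (hω.1 l h).2
      have hbin : ω [p] = 0 ∨ ω [p] = 1 := by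
        generalize ω [p] = z
        revert z
        decide
      refine hbin.imp (fun h => ?_) fun h => ?_
      · refine mem_coboundaries_of_locZero fun q => locZero_iff_of_unique.2 (funext fun l => ?_)
        by_cases hl : l.length = 1
        · obtain ⟨q, rfl⟩ := List.length_eq_one_iff.1 hl
          rw [Subsingleton.elim q p, h]
          rfl
        · exact hz l hl
      · refine mem_coboundaries_of_locZero fun q => locZero_iff_of_unique.2 (funext fun l => ?_)
        by_cases hl : l.length = 1
        · obtain ⟨q, rfl⟩ := List.length_eq_one_iff.1 hl
          rw [Pi.add_apply, Subsingleton.elim q p, h]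
          rfl
        · simp [hz l hl, hg, hl]

end Point

section Product

variable [TopologicalSpace X] {U : Set X} {ω β : Cochain X} {a b c : ℝ} {m n : ℕ}

lemma locZero_cut {D : Set X} (hD : IsClosed D) (h0 : ω [] = 0) {p : X}
    (h : p ∈ D → LocZero ω p) : LocZero (cut D ω) p := by
  by_cases hp : p ∈ D
  · exact (h hp).cut D
  · exact locZero_cut_of_notMem hD h0 hp

lemma exists_Ioo_of_isCompact {C : Set ℝ} (hC : IsCompact C) (hab : a < b) (h : C ⊆ Ioo a b) :
    ∃ a' b', a < a' ∧ a' < b' ∧ b' < b ∧ C ⊆ Ioo a' b' := by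
  rcases C.eq_empty_or_nonempty with rfl | hne
  · obtain ⟨a', h1, h2⟩ := exists_between hab
    obtain ⟨b', h3, h4⟩ := exists_between h2
    exact ⟨a', b', h1, h3, h4, empty_subset _⟩
  · obtain ⟨s, hs, hs'⟩ := hC.exists_isLeast hne
    obtain ⟨t, ht, ht'⟩ := hC.exists_isGreatest hne
    obtain ⟨a', h1, h2⟩ := exists_between (h hs).1
    obtain ⟨b', h3, h4⟩ := exists_between (h ht).2
    exact ⟨a', b', h1, (h2.trans_le (hs' ht)).trans h3, h4, fun r hr =>
      ⟨h2.trans_le (hs' hr), (ht' hr).trans_lt h3⟩⟩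

/-- The indicator function of the half space `{z | z.2 ≤ c}`. -/
noncomputable def below (c : ℝ) : X × ℝ → ZMod 2 := {z | z.2 ≤ c}.indicator 1

lemma eventually_below_eq_one {p : X × ℝ} (h : p.2 < c) : ∀ᶠ q in 𝓝 p, below c q = 1 := by
  filter_upwards [(isOpen_Iio.preimage continuous_snd).mem_nhds h] with q hq
  exact indicator_of_mem (show q ∈ {z : X × ℝ | z.2 ≤ c} from le_of_lt (show q.2 < c from hq)) _

lemma eventually_below_eq_zero {p : X × ℝ} (h : c < p.2) : ∀ᶠ q in 𝓝 p, below c q = 0 := by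
  filter_upwards [(isOpen_Ioi.preimage continuous_snd).mem_nhds h] with q hq
  exact indicator_of_notMem (show q ∉ {z : X × ℝ | z.2 ≤ c} from not_le_of_gt (show c < q.2 from hq)) _

lemma locZero_cupD_below {ω : Cochain (X × ℝ)} {p : X × ℝ} (h : p.2 ≠ c) :
    LocZero (cupD (below c) ω) p :=
  h.lt_or_gt.elim (fun h => locZero_cupD_of_const (eventually_below_eq_one h))
    fun h => locZero_cupD_of_const (eventually_below_eq_zero h)

lemma LocZero.pull_fst {p : X × ℝ} (h : LocZero β p.1) : LocZero (AlexanderSpanier.pull Prod.fst β) p :=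
  h.pull continuous_fst.continuousAt

lemma SuppIn.cupD_pull_fst {A : Set X} (h : SuppIn A β) (c : ℝ) :
    SuppIn (A ×ˢ {c}) (cupD (below c) (pull Prod.fst β)) := by
  obtain ⟨K, hK, hKA, h⟩ := h
  refine ⟨K ×ˢ {c}, hK.prod isCompact_singleton, prod_mono_left hKA, fun p hp => ?_⟩
  by_cases hpc : p.2 = c
  · exact (h p.1 fun hpK => hp ⟨hpK, hpc⟩).pull_fst.cupD _
  · exact locZero_cupD_below hpc

lemma cupD_mem_cocycles {A : Set X} (h : β ∈ cocycles m A) (c : ℝ) :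
    cupD (below c) (pull Prod.fst β) ∈ cocycles (m + 1) (A ×ˢ {c}) :=
  ⟨(h.1.pull _).cupD _, fun p => by
    rw [d_cupD _ (h.1.pull _).nil, d_pull]
    exact (h.2.1 p.1).pull_fst.cupD _, h.2.2.cupD_pull_fst c⟩

lemma cupD_mem_coboundaries (h : β ∈ coboundaries m U) (hc : c ∈ Ioo a b) :
    cupD (below c) (pull Prod.fst β) ∈ coboundaries (m + 1) (U ×ˢ Ioo a b) := by
  obtain ⟨η, h1, h2, h3⟩ := h
  refine ⟨cupD (below c) (pull Prod.fst η), (h1.pull _).cupD _, (h2.cupD_pull_fst c).mono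
    (prod_mono_right (singleton_subset_iff.2 hc)), fun p => ?_⟩
  rw [d_cupD _ (h1.pull _).nil, d_pull, ← map_add, ← map_add]
  exact (h3 p.1).pull_fst.cupD _

lemma cupD_add_cupD_mem_coboundaries (h : β ∈ cocycles m U) {c' : ℝ} (hc : c ∈ Ioo a b)
    (hc' : c' ∈ Ioo a b) :
    cupD (below c) (pull Prod.fst β) + cupD (below c') (pull Prod.fst β) ∈
      coboundaries m (U ×ˢ Ioo a b) := by
  have h0 := (h.1.pull (Prod.fst : X × ℝ → X)).nil
  obtain ⟨K, hK, hKU, hsupp⟩ := h.2.2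
  refine ⟨mulHead (below c) (pull Prod.fst β) + mulHead (below c') (pull Prod.fst β),
    ((h.1.pull _).mulHead _).add ((h.1.pull _).mulHead _),
    ⟨K ×ˢ uIcc c c', hK.prod isCompact_uIcc, prod_mono hKU ?_, fun p hp => ?_⟩, fun p => ?_⟩
  · exact fun r hr => ⟨(lt_min hc.1 hc'.1).trans_le hr.1, hr.2.trans_lt (max_lt hc.2 hc'.2)⟩
  · by_cases hpK : p.1 ∈ K
    · have hp2 : ¬ p.2 ∈ uIcc c c' := fun h2 => hp ⟨hpK, h2⟩
      rw [mem_uIcc] at hp2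
      push Not at hp2
      by_cases h1 : p.2 < c
      · have h2 : p.2 < c' := by
          by_contra! h2
          exact absurd (hp2.2 h2) (by linarith)
        have := (locZero_mulHead_add_self h0 (eventually_below_eq_one h1)).add
          (locZero_mulHead_add_self h0 (eventually_below_eq_one h2))
        rwa [add_add_add_comm, ZModModule.add_self, add_zero] at this
      · push Not at h1
        have h3 := hp2.1 h1
        have h4 : c < p.2 := lt_of_le_of_ne h1 fun h4 => absurd (hp2.2 (by linarith)) (by linarith)
        exact (locZero_mulHead_of_eq_zero (eventually_below_eq_zero h4)).add
          (locZero_mulHead_of_eq_zero (eventually_below_eq_zero h3))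
    · exact ((hsupp _ hpK).pull_fst.mulHead _).add ((hsupp _ hpK).pull_fst.mulHead _)
  · have hd := (h.2.1 p.1).pull_fst (p := p)
    rw [← d_pull] at hd
    rw [map_add, d_mulHead _ h0, d_mulHead _ h0, add_add_add_comm (cupD (below c) _),
      ← add_assoc (cupD (below c) _), ← add_assoc (cupD (below c') _), ZModModule.add_self,
      ZModModule.add_self, zero_add, zero_add]
    exact (hd.mulHead _).add (hd.mulHead _)

lemma mem_coboundaries_of_cupD_mem [T2Space X] [LocallyCompactSpace X] (hU : IsOpen U)
    (hβ : β ∈ cocycles (n + 1) U) (hc : c ∈ Ioo a b)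
    (h : cupD (below c) (pull Prod.fst β) ∈ coboundaries (n + 1) (U ×ˢ Ioo a b)) :
    β ∈ coboundaries n U := by
  obtain ⟨η, hη, ⟨K, hK, hKU, hsupp⟩, hd⟩ := h
  obtain ⟨Kβ, hKβ, hKβU, hsuppβ⟩ := hβ.2.2
  have h0 := (hβ.1.pull (Prod.fst : X × ℝ → X)).nil
  obtain ⟨L₀, hL₀, hKL₀, hL₀U⟩ := exists_compact_between
    ((hK.image continuous_fst).union hKβ) hU (union_subset (by
      rintro _ ⟨q, hq, rfl⟩
      exact (hKU hq).1) hKβU)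
  obtain ⟨L, hL, hL₀L, hLU⟩ := exists_compact_between hL₀ hU hL₀U
  set θ := mulHead (below c) (pull Prod.fst β) + η with hθ
  have hθd : ∀ p, LocZero (d θ) p := fun p => by
    rw [hθ, map_add, d_mulHead _ h0, add_right_comm]
    refine (hd p).add (LocZero.mulHead ?_ _)
    rw [d_pull]
    exact (hβ.2.1 p.1).pull_fst
  have hθs : ∀ p : X × ℝ, p.1 ∉ interior L₀ → LocZero θ p := fun p hp =>
    ((hsuppβ p.1 fun h => hp (hKL₀ (Or.inr h))).pull_fst.mulHead _).add
      (hsupp p fun h => hp (hKL₀ (Or.inl ⟨p, h, rfl⟩)))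
  obtain ⟨ζ, hζ, hζ1, hζ2⟩ := exists_homotopy (F := fun z : ℝ × X => (z.2, z.1)) (by fun_prop)
    hL (isOpen_interior (s := L₀) |>.prod isOpen_univ) (((hβ.1.pull _).mulHead _).add hη)
    (fun t p _ => hθd _) (fun t p _ hp => hθs _ fun h => hp ⟨h, mem_univ _⟩) a b
  have hζ0 : ∀ p ∉ interior L₀, LocZero (cut L ζ) p := fun p hp =>
    locZero_cut hL.isClosed hζ.nil fun hpL => hζ2 p hpL fun r hr => hp hr.1
  refine ⟨cut L ζ, hζ.cut L, ⟨L₀, hL₀, hL₀U, fun p hp => hζ0 p fun h => hp (interior_subset h)⟩,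
    fun p => ?_⟩
  by_cases hp : p ∈ interior L₀
  · have hpL := hL₀L (interior_subset hp)
    have h1 := hζ1 p (interior_subset hpL)
    have h2 : LocZero (pull (fun q : X => (q, b)) θ) p := by
      refine LocZero.pull (by fun_prop) ((locZero_mulHead_of_eq_zero
        (eventually_below_eq_zero hc.2)).add (hsupp _ fun h => ?_))
      exact lt_irrefl _ (hKU h).2.2
    have h3 : LocZero (pull (fun q : X => (q, a)) (θ + pull Prod.fst β)) p := by
      refine LocZero.pull (by fun_prop) ?_
      rw [hθ, add_right_comm]
      refine (locZero_mulHead_add_self h0 (eventually_below_eq_one hc.1)).add (hsupp _ fun h => ?_)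
      exact lt_irrefl _ (hKU h).2.1
    have h4 : pull (fun q : X => (q, a)) (pull Prod.fst β) = β := by
      ext l
      simp [pull_apply, Function.comp_def]
    have h5 := (locZero_cut_add_self (ω := ζ) (mem_interior_iff_mem_nhds.1 hpL)).d
    rw [map_add, h4] at h3
    rw [map_add] at h5
    have h6 := ((h1.add h2).add h3).add h5
    change LocZero (pull (fun q => (q, a)) θ + pull (fun q => (q, b)) θ + d ζ +
      pull (fun q => (q, b)) θ + (pull (fun q => (q, a)) θ + β) + (d (cut L ζ) + d ζ)) p at h6
    rwa [show ∀ x y z u v : Cochain X, x + y + z + y + (x + u) + (v + z) =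
      u + v + (x + x) + (y + y) + (z + z) by intros; abel, ZModModule.add_self,
      ZModModule.add_self, ZModModule.add_self, add_zero, add_zero, add_zero] at h6
  · exact (hsuppβ p fun h => hp (hKL₀ (Or.inr h))).add (hζ0 p hp).d

end Product

section ProductCell

variable [TopologicalSpace X] [T2Space X] [LocallyCompactSpace X] {U : Set X} {a b : ℝ}
  {m n : ℕ}

/-- A compactly supported cocycle on `U × (a, b)` has, below the level `b`, a primitive whose
support is compact modulo that level. -/
lemma exists_primitive (hU : IsOpen U) {ω : Cochain (X × ℝ)} (hab : a < b)
    (hω : ω ∈ cocycles (m + 2) (U ×ˢ Ioo a b)) :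
    ∃ (ζ : Cochain (X × ℝ)) (L₀ : Set X) (a' b' : ℝ), HasLen (m + 1) ζ ∧ IsCompact L₀ ∧ L₀ ⊆ U ∧
      a < a' ∧ a' < b' ∧ b' < b ∧ (∀ p, p.1 ∉ L₀ ∨ p.2 ≤ a' → LocZero ζ p) ∧
      (∀ p, p.1 ∉ L₀ ∨ b' ≤ p.2 → LocZero ω p) ∧ ∀ p, p.2 < b → LocZero (ω + d ζ) p := by
  obtain ⟨hlen, hd, K, hK, hKU, hsupp⟩ := hω
  obtain ⟨a', b', haa', hab', hbb', hK₂⟩ := exists_Ioo_of_isCompact (hK.image continuous_snd) hab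
    (by rintro _ ⟨q, hq, rfl⟩; exact (hKU hq).2)
  obtain ⟨L₀, hL₀, hKL₀, hL₀U⟩ := exists_compact_between (hK.image continuous_fst) hU (by
    rintro _ ⟨q, hq, rfl⟩
    exact (hKU hq).1)
  obtain ⟨L₁, hL₁, hL₀L₁, hL₁U⟩ := exists_compact_between hL₀ hU hL₀U
  set L := L₁ ×ˢ Icc a b with hLdef
  have hL : IsCompact L := hL₁.prod isCompact_Icc
  obtain ⟨ζ, hζ, hζ1, hζ2⟩ := exists_homotopy
    (F := fun z : ℝ × (X × ℝ) => (z.2.1, min z.2.2 z.1)) (by fun_prop) hL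
    (isOpen_interior (s := L₀) |>.prod (isOpen_Ioo (a := a') (b := b'))) hlen
    (fun t p _ => hd _) (fun t p _ hp => hsupp _ fun h => hp
      ⟨hKL₀ ⟨_, h, rfl⟩, hK₂ ⟨_, h, rfl⟩⟩) b a
  have hcut : ∀ p : X × ℝ, p.1 ∉ L₀ ∨ p.2 ≤ a' → LocZero (cut L ζ) p := fun p hp =>
    locZero_cut hL.isClosed hζ.nil fun hpL => hζ2 p hpL fun r hr => by
      rcases hp with hp | hp
      · exact hp (interior_subset hr.1)
      · exact absurd (lt_min_iff.1 hr.2.1).1 hp.not_gt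
  have hωz : ∀ p : X × ℝ, p.1 ∉ L₀ ∨ ¬ (a' < p.2 ∧ p.2 < b') → LocZero ω p := fun p hp =>
    hsupp p fun h => hp.elim (fun hp => hp (interior_subset (hKL₀ ⟨p, h, rfl⟩)))
      fun hp => hp (hK₂ ⟨p, h, rfl⟩)
  refine ⟨cut L ζ, L₀, a', b', hζ.cut L, hL₀, hL₀U, haa', hab', hbb', hcut,
    fun p hp => hωz p (hp.imp_right fun h h' => h'.2.not_ge h), fun p hpb => ?_⟩
  by_cases hp : p.1 ∉ L₀ ∨ p.2 ≤ a'
  · exact (hωz p (hp.imp_right fun h h' => h'.1.not_ge h)).add (hcut p hp).d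
  · push Not at hp
    have hpL : L ∈ 𝓝 p := prod_mem_nhds (mem_interior_iff_mem_nhds.1 (hL₀L₁ hp.1))
      (Icc_mem_nhds (haa'.trans hp.2) hpb)
    have h1 := hζ1 p (mem_of_mem_nhds hpL)
    have h2 : LocZero (pull (fun q : X × ℝ => (q.1, min q.2 a)) ω) p :=
      LocZero.pull (by fun_prop) (hωz _ (Or.inr fun h => by
        have := min_le_right p.2 a
        linarith [h.1]))
    have h3 : LocZero (pull (fun q : X × ℝ => (q.1, min q.2 b)) ω + ω) p := by
      have hN : {q : X × ℝ | q.2 < b} ∈ 𝓝 p := (isOpen_Iio.preimage continuous_snd).mem_nhds hpb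
      refine LocZero.of_eq hN fun l hl => ?_
      rw [pull_apply]
      congr 1
      refine (List.map_congr_left fun q hq => ?_).trans (List.map_id l)
      rw [min_eq_left (le_of_lt (show q.2 < b from hl q hq))]
      rfl
    have h4 := (locZero_cut_add_self (ω := ζ) hpL).d
    rw [map_add] at h4
    have h5 := ((h1.add h2).add h3).add h4
    rwa [show ∀ x y z u v : Cochain (X × ℝ), x + y + z + y + (x + u) + (v + z) =
      u + v + (x + x) + (y + y) + (z + z) by intros; abel, ZModModule.add_self,
      ZModModule.add_self, ZModModule.add_self, add_zero, add_zero, add_zero] at h5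

/-- Every compactly supported class on `U × (a, b)` is the suspension of a class on `U`. -/
lemma exists_suspension (hU : IsOpen U) {ω : Cochain (X × ℝ)} (hab : a < b)
    (hω : ω ∈ cocycles (m + 2) (U ×ˢ Ioo a b)) :
    ∃ c ∈ Ioo a b, ∃ β ∈ cocycles (m + 1) U,
      ω + cupD (below c) (pull Prod.fst β) ∈ coboundaries (m + 1) (U ×ˢ Ioo a b) := by
  obtain ⟨ζ, L₀, a', b', hζ, hL₀, hL₀U, haa', hab', hbb', hζ0, hω0, hωζ⟩ :=
    exists_primitive hU hab hω
  obtain ⟨c, hb'c, hcb⟩ := exists_between hbb'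
  obtain ⟨ε, hε, hε1, hε2⟩ : ∃ ε > 0, b' < c - ε ∧ c + ε < b := by
    refine ⟨min (c - b') (b - c) / 2, by have := lt_min (sub_pos.2 hb'c) (sub_pos.2 hcb); linarith,
      ?_, ?_⟩
    · have := min_le_left (c - b') (b - c); linarith
    · have := min_le_right (c - b') (b - c); linarith
  have hdζ : ∀ p : X × ℝ, b' ≤ p.2 → p.2 < b → LocZero (d ζ) p := fun p h1 h2 =>
    (hωζ p h2).of_add (hω0 p (Or.inr h1))
  set β : Cochain X := pull (fun x => (x, c)) ζ with hβ
  have hβlen : HasLen (m + 1) β := hζ.pull _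
  have hβ0 : ∀ x ∉ L₀, LocZero β x := fun x hx => LocZero.pull (by fun_prop) (hζ0 _ (Or.inl hx))
  have hβmem : β ∈ cocycles (m + 1) U := ⟨hβlen, fun x => by
    rw [hβ, d_pull]
    exact LocZero.pull (by fun_prop) (hdζ _ hb'c.le hcb), L₀, hL₀, hL₀U, hβ0⟩
  obtain ⟨L₁, hL₁, hL₀L₁, hL₁U⟩ := exists_compact_between hL₀ hU hL₀U
  set L := L₁ ×ˢ Icc (c - ε) (c + ε) with hLdef
  have hL : IsCompact L := hL₁.prod isCompact_Icc
  obtain ⟨κ, hκ, hκ1, hκ2⟩ := exists_homotopy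
    (F := fun z : unitInterval × (X × ℝ) => (z.2.1, c + z.1 * (z.2.2 - c))) (by fun_prop) hL
    (isOpen_interior (s := L₁) |>.prod isOpen_univ) hζ
    (fun t p hp => by
      obtain ⟨h1, h2⟩ := hp.2
      have ht0 := t.2.1
      have ht1 := t.2.2
      refine hdζ _ ?_ ?_ <;> simp only <;> nlinarith)
    (fun t p _ hp => hζ0 _ (Or.inl fun h => hp ⟨hL₀L₁ h, mem_univ _⟩)) 1 0
  have hκ0 : ∀ p : X × ℝ, p.1 ∉ interior L₁ → LocZero (cut L κ) p := fun p hp =>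
    locZero_cut hL.isClosed hκ.nil fun hpL => hκ2 p hpL fun r hr => hp hr.1
  have hF1 : pull (fun q : X × ℝ => (q.1, c + ((1 : unitInterval) : ℝ) * (q.2 - c))) ζ = ζ := by
    ext l
    simp [pull_apply]
  have hF0 : pull (fun q : X × ℝ => (q.1, c + ((0 : unitInterval) : ℝ) * (q.2 - c))) ζ =
      pull Prod.fst β := by
    ext l
    simp [pull_apply, hβ, Function.comp_def]
  have hζβ : ∀ p : X × ℝ, p.2 = c → LocZero (ζ + pull Prod.fst β + d (cut L κ)) p := by
    intro p hpc
    by_cases hp : p.1 ∈ interior L₁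
    · have hpL : L ∈ 𝓝 p := prod_mem_nhds (mem_interior_iff_mem_nhds.1 hp)
        (Icc_mem_nhds (by linarith) (by linarith))
      have h1 := hκ1 p (mem_of_mem_nhds hpL)
      have h2 := (locZero_cut_add_self (ω := κ) hpL).d
      rw [map_add] at h2
      simp only [hF1, hF0] at h1
      exact h1.trans (add_comm (d (cut L κ)) _ ▸ h2)
    · have hp0 : p.1 ∉ L₀ := fun h => hp (hL₀L₁ h)
      exact ((hζ0 p (Or.inl hp0)).add (hβ0 _ hp0).pull_fst).add (hκ0 p hp).d
  have hc : c ∈ Ioo a b := ⟨haa'.trans (hab'.trans hb'c), hcb⟩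
  refine ⟨c, hc, β, hβmem, mulHead (below c) ζ + cupD (below c) (cut L κ),
    (hζ.mulHead _).add ((hκ.cut L).cupD _),
    SuppIn.add ⟨L₀ ×ˢ Icc a' c, hL₀.prod isCompact_Icc, prod_mono hL₀U
      fun r hr => ⟨haa'.trans_le hr.1, hr.2.trans_lt hcb⟩, fun p hp => ?_⟩
      ⟨L₁ ×ˢ {c}, hL₁.prod isCompact_singleton, prod_mono hL₁U (singleton_subset_iff.2 hc),
        fun p hp => ?_⟩, fun p => ?_⟩
  · by_cases h1 : p.1 ∉ L₀ ∨ p.2 ≤ a'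
    · exact (hζ0 p h1).mulHead _
    · push Not at h1
      refine locZero_mulHead_of_eq_zero (eventually_below_eq_zero ?_)
      by_contra! h2
      exact hp ⟨h1.1, h1.2.le, h2⟩
  · by_cases h1 : p.2 = c
    · exact (hκ0 p fun h => hp ⟨interior_subset h, h1⟩).cupD _
    · exact locZero_cupD_below h1
  · have h1 : LocZero (ω + mulHead (below c) (d ζ)) p := by
      by_cases hpb : p.2 < b
      · have h2 := (hωζ p hpb).mulHead (below c)
        rw [map_add] at h2
        refine LocZero.trans ?_ h2
        rw [add_comm]
        by_cases hpc : p.2 < c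
        · exact locZero_mulHead_add_self hω.1.nil (eventually_below_eq_one hpc)
        · have := hω0 p (Or.inr (hb'c.le.trans (not_lt.1 hpc)))
          exact (this.mulHead _).add this
      · exact (hω0 p (Or.inr (by linarith))).add
          (locZero_mulHead_of_eq_zero (eventually_below_eq_zero (by linarith)))
    have h2 : LocZero (cupD (below c) (ζ + pull Prod.fst β + d (cut L κ))) p := by
      by_cases hpc : p.2 = c
      · exact (hζβ p hpc).cupD _
      · exact locZero_cupD_below hpc
    rw [map_add, d_mulHead _ hζ.nil, d_cupD _ (hκ.cut L).nil]
    rw [map_add, map_add] at h2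
    convert h1.add h2 using 1
    abel

lemma IsCell.prod (hU : IsCell n U) (hab : a < b) : IsCell (n + 1) (U ×ˢ Ioo a b) := by
  refine ⟨hU.isOpen.prod isOpen_Ioo, fun m hm ω hω => ?_, ?_⟩
  · obtain ⟨m, rfl⟩ : ∃ k, m = k + 1 := ⟨m - 1, by omega⟩
    obtain ⟨c, hc, β, hβ, h⟩ := exists_suspension hU.isOpen hab hω
    exact (Submodule.add_mem_iff_left _ (cupD_mem_coboundaries
      (hU.vanish m (by omega) hβ) hc)).1 h
  · rintro ⟨x, t⟩ ⟨hx, ht⟩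
    obtain ⟨g, hg, hgU, hgen⟩ := hU.exists_generator x hx
    have hgU' := cocycles_mono (singleton_subset_iff.2 hx) hg
    refine ⟨cupD (below t) (pull Prod.fst g), singleton_prod_singleton ▸ cupD_mem_cocycles hg t,
      fun h => hgU (mem_coboundaries_of_cupD_mem hU.isOpen hgU' ht h), fun ω hω => ?_⟩
    obtain ⟨c, hc, β, hβ, h⟩ := exists_suspension hU.isOpen hab hω
    have h1 := cupD_add_cupD_mem_coboundaries hβ hc ht
    have h2 := Submodule.add_mem _ h h1
    rw [← add_assoc, add_assoc ω, ZModModule.add_self, add_zero] at h2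
    refine (hgen β hβ).imp (fun h3 => ?_) fun h3 => ?_
    · exact (Submodule.add_mem_iff_left _ (cupD_mem_coboundaries h3 ht)).1 h2
    · have h3 := cupD_mem_coboundaries h3 ht
      rw [map_add, map_add] at h3
      have := Submodule.add_mem _ h2 h3
      rwa [← add_assoc, add_assoc ω, ZModModule.add_self, add_zero] at this

end ProductCell

section Transfer

variable [TopologicalSpace X] [TopologicalSpace Y] (e : OpenPartialHomeomorph X Y) {U A : Set X}
  {ω η : Cochain X} {ω' η' : Cochain Y} {m n : ℕ}

/-- The cochain `ω'` on the target of `e` is locally transported to `ω` over `U`. -/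
def Corresponds (U : Set X) (ω' : Cochain Y) (ω : Cochain X) : Prop :=
  ∀ p ∈ U, LocZero (pull e ω' + ω) p

variable {e}

lemma locZero_apply_of_pull {p : X} (hp : p ∈ e.source) (h : LocZero (pull e ω') p) :
    LocZero ω' (e p) := by
  have h1 : LocZero (pull e.symm (pull e ω')) (e p) :=
    LocZero.pull (e.symm.continuousAt (e.map_source hp)) (by rwa [e.left_inv hp])
  refine LocZero.of_add (LocZero.of_eq (e.open_target.mem_nhds (e.map_source hp)) ?_) h1
  intro l hl
  rw [pull_apply, pull_apply, List.map_map]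
  exact congrArg ω' ((List.map_congr_left fun q hq => e.right_inv (hl q hq)).trans (List.map_id l))

lemma locZero_pull_pull_symm {p : X} (hp : p ∈ e.source) :
    LocZero (pull e (pull e.symm ω) + ω) p := by
  refine LocZero.of_eq (e.open_source.mem_nhds hp) fun l hl => ?_
  rw [pull_apply, pull_apply, List.map_map]
  exact congrArg ω ((List.map_congr_left fun q hq => e.left_inv (hl q hq)).trans (List.map_id l))

lemma Corresponds.symm (hU : U ⊆ e.source) (h : Corresponds e U ω' ω) :
    Corresponds e.symm (e '' U) ω ω' := by
  rintro _ ⟨p, hp, rfl⟩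
  refine locZero_apply_of_pull (hU hp) ?_
  rw [map_add]
  exact (locZero_pull_pull_symm (hU hp)).trans (add_comm ω _ ▸ h p hp)

lemma Corresponds.add (h : Corresponds e U ω' ω) (h' : Corresponds e U η' η) :
    Corresponds e U (ω' + η') (ω + η) := fun p hp => by
  rw [map_add, add_add_add_comm]
  exact (h p hp).add (h' p hp)

lemma Corresponds.d (h : Corresponds e U ω' ω) :
    Corresponds e U (d ω') (d ω) := fun p hp => by
  rw [← d_pull, ← map_add]
  exact (h p hp).d

lemma Corresponds.locZero (hU : U ⊆ e.source) (h : Corresponds e U ω' ω) {p : X} (hp : p ∈ U)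
    (h0 : LocZero ω p) : LocZero ω' (e p) :=
  locZero_apply_of_pull (hU hp) ((h p hp).of_add' h0)

lemma exists_corresponds [LocallyCompactSpace X] [T2Space Y] (hU : IsOpen U) (hUe : U ⊆ e.source)
    (hA : A ⊆ U) (hη : HasLen m η) (hs : SuppIn A η) :
    ∃ η', HasLen m η' ∧ SuppIn (e '' A) η' ∧ Corresponds e U η' η := by
  obtain ⟨K, hK, hKA, hsupp⟩ := hs
  obtain ⟨D, hD, hKD, hDU⟩ := exists_compact_between hK hU (hKA.trans hA)
  have hcont : ContinuousOn e U := e.continuousOn.mono hUe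
  have h0 : ∀ q ∉ e '' K, LocZero (cut (e '' D) (pull e.symm η)) q := fun q hq =>
    locZero_cut (hD.image_of_continuousOn (hcont.mono hDU)).isClosed (hη.pull _).nil (by
      rintro ⟨p, hp, rfl⟩
      have hps := hUe (hDU hp)
      refine LocZero.pull (e.symm.continuousAt (e.map_source hps)) ?_
      rw [e.left_inv hps]
      exact hsupp p fun h => hq ⟨p, h, rfl⟩)
  refine ⟨cut (e '' D) (pull e.symm η), (hη.pull _).cut _, ⟨e '' K,
    hK.image_of_continuousOn (hcont.mono (hKA.trans hA)), image_mono hKA, h0⟩, fun p hp => ?_⟩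
  by_cases hpD : p ∈ interior D
  · refine LocZero.trans ?_ (locZero_pull_pull_symm (hUe hp))
    rw [← map_add]
    exact LocZero.pull (e.continuousAt (hUe hp)) (locZero_cut_add_self
      (e.image_mem_nhds (hUe hp) (mem_interior_iff_mem_nhds.1 hpD)))
  · have hpK : p ∉ K := fun h => hpD (hKD h)
    refine LocZero.add (LocZero.pull (e.continuousAt (hUe hp)) (h0 _ ?_)) (hsupp p hpK)
    rintro ⟨r, hr, hrp⟩
    exact hpK (e.injOn (hUe (hA (hKA hr))) (hUe hp) hrp ▸ hr)

lemma exists_cocycle_corresponds [LocallyCompactSpace X] [T2Space Y] (hU : IsOpen U)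
    (hUe : U ⊆ e.source) (hA : A ⊆ U) (hω : ω ∈ cocycles m A) :
    ∃ ω' ∈ cocycles m (e '' A), Corresponds e U ω' ω := by
  obtain ⟨ω', h1, h2, h3⟩ := exists_corresponds hU hUe hA hω.1 hω.2.2
  refine ⟨ω', ⟨h1, fun q => ?_, h2⟩, h3⟩
  obtain ⟨K, -, hKA, h⟩ := h2
  by_cases hq : q ∈ K
  · obtain ⟨p, hp, rfl⟩ := hKA hq
    exact h3.d.locZero hUe (hA hp) (hω.2.1 p)
  · exact (h q hq).d

lemma Corresponds.mem_coboundaries [LocallyCompactSpace X] [T2Space Y] (hU : IsOpen U)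
    (hUe : U ⊆ e.source) (h : Corresponds e U ω' ω) (hs : SuppIn (e '' U) ω')
    (hω : ω ∈ coboundaries m U) : ω' ∈ coboundaries m (e '' U) := by
  obtain ⟨η, h1, h2, h3⟩ := hω
  obtain ⟨η', h4, h5, h6⟩ := exists_corresponds hU hUe Subset.rfl h1 h2
  refine ⟨η', h4, h5, fun q => ?_⟩
  obtain ⟨K, -, hKU, h0⟩ := hs.add h5.d
  by_cases hq : q ∈ K
  · obtain ⟨p, hp, rfl⟩ := hKU hq
    exact (h.add h6.d).locZero hUe hp (h3 p)
  · exact h0 q hq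

lemma IsCell.image [T2Space X] [LocallyCompactSpace X] [T2Space Y] [LocallyCompactSpace Y]
    (hU : IsCell n U) (hUe : U ⊆ e.source) : IsCell n (e '' U) := by
  have hopen : IsOpen (e '' U) := (e.isOpen_image_iff_of_subset_source hUe).2 hU.isOpen
  have hUe' : e '' U ⊆ e.symm.source := by
    rintro _ ⟨p, hp, rfl⟩
    exact e.map_source (hUe hp)
  have hUU : e.symm '' (e '' U) = U := e.toPartialEquiv.symm_image_image_of_subset_source hUe
  have back : ∀ k, ∀ ω' ∈ cocycles k (e '' U), ∃ ω ∈ cocycles k U, Corresponds e U ω' ω := by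
    intro k ω' hω'
    obtain ⟨ω, h1, h2⟩ := exists_cocycle_corresponds hopen hUe' Subset.rfl hω'
    have h3 := h2.symm hUe'
    rw [hUU] at h1 h3
    exact ⟨ω, h1, h3⟩
  refine ⟨hopen, fun m hm ω' hω' => ?_, ?_⟩
  · obtain ⟨ω, h1, h2⟩ := back _ ω' hω'
    exact h2.mem_coboundaries hU.isOpen hUe hω'.2.2 (hU.vanish m hm h1)
  · rintro _ ⟨p, hp, rfl⟩
    obtain ⟨g, hg, hgU, hgen⟩ := hU.exists_generator p hp
    have hpU := singleton_subset_iff.2 hp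
    obtain ⟨g', hg', hgg'⟩ := exists_cocycle_corresponds hU.isOpen hUe hpU hg
    have hgs' : SuppIn (e '' U) g' := hg'.2.2.mono (image_mono hpU)
    rw [image_singleton] at hg'
    refine ⟨g', hg', fun h => hgU ?_, fun ω' hω' => ?_⟩
    · have := (hgg'.symm hUe).mem_coboundaries hopen hUe' (hUU.symm ▸ hg.2.2.mono hpU) h
      rwa [hUU] at this
    · obtain ⟨ω, h1, h2⟩ := back _ ω' hω'
      exact (hgen ω h1).imp (h2.mem_coboundaries hU.isOpen hUe hω'.2.2)
        ((h2.add hgg').mem_coboundaries hU.isOpen hUe (hω'.2.2.add hgs'))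

end Transfer

lemma isCell_pi_Ioo {n : ℕ} (a b : Fin n → ℝ) (h : ∀ i, a i < b i) :
    IsCell n (univ.pi fun i => Ioo (a i) (b i)) := by
  induction n with
  | zero =>
    rw [show (univ.pi fun i => Ioo (a i) (b i)) = univ from eq_univ_of_forall fun v i => i.elim0]
    exact isCell_of_unique
  | succ n ih =>
    have h1 := (ih (fun i => a i.succ) (fun i => b i.succ) fun i => h i.succ).prod (h 0)
    have h2 := h1.image (e := ((Homeomorph.prodComm _ _).trans
      (Fin.consEquivL ℝ (fun _ : Fin (n + 1) => ℝ)).toHomeomorph).toOpenPartialHomeomorph)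
      (subset_univ _)
    convert h2 using 1
    ext v
    constructor
    · intro hv
      refine ⟨(fun i => v i.succ, v 0), ⟨fun i _ => hv i.succ (mem_univ _), hv 0 (mem_univ _)⟩, ?_⟩
      exact Fin.cons_self_tail v
    · rintro ⟨⟨w, t⟩, ⟨hw, ht⟩, rfl⟩ i -
      refine Fin.cases ?_ (fun j => ?_) i
      · exact ht
      · exact hw j (mem_univ _)

section Manifold

variable [TopologicalSpace X] {n : ℕ}

/-- The coordinate boxes of a chart, together with the empty set. -/
def chartBoxes (e : OpenPartialHomeomorph X (Fin n → ℝ)) : Set (Set X) :=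
  {B | B = ∅ ∨ ∃ a b : Fin n → ℝ, (∀ i, a i < b i) ∧
    (univ.pi fun i => Ioo (a i) (b i)) ⊆ e.target ∧ B = e.symm '' univ.pi fun i => Ioo (a i) (b i)}

variable {e : OpenPartialHomeomorph X (Fin n → ℝ)}

lemma inter_mem_chartBoxes {B C : Set X} (hB : B ∈ chartBoxes e) (hC : C ∈ chartBoxes e) :
    B ∩ C ∈ chartBoxes e := by
  rcases hB with rfl | ⟨a, b, -, hB, rfl⟩
  · exact Or.inl (empty_inter _)
  rcases hC with rfl | ⟨a', b', -, hC, rfl⟩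
  · exact Or.inl (inter_empty _)
  have hI : (univ.pi fun i => Ioo (a i) (b i)) ∩ (univ.pi fun i => Ioo (a' i) (b' i)) =
      univ.pi fun i => Ioo (max (a i) (a' i)) (min (b i) (b' i)) := by
    rw [← pi_inter_distrib]
    simp only [Ioo_inter_Ioo]
  rw [← e.symm.injOn.image_inter hB hC, hI]
  by_cases h : ∀ i, max (a i) (a' i) < min (b i) (b' i)
  · exact Or.inr ⟨_, _, h, hI ▸ inter_subset_left.trans hB, rfl⟩
  · push Not at h
    obtain ⟨i, hi⟩ := h
    exact Or.inl (image_eq_empty.2 (univ_pi_eq_empty (i := i) (Ioo_eq_empty hi.not_gt)))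

lemma exists_mem_chartBoxes {U : Set X} (hU : IsOpen U) (hUe : U ⊆ e.source) {p : X} (hp : p ∈ U) :
    ∃ B ∈ chartBoxes e, p ∈ B ∧ B ⊆ U := by
  obtain ⟨ε, hε, hball⟩ := Metric.isOpen_iff.1 ((e.isOpen_image_iff_of_subset_source hUe).2 hU)
    (e p) ⟨p, hp, rfl⟩
  have hpi : ball (e p) ε = univ.pi fun i => Ioo (e p i - ε) (e p i + ε) := by
    rw [ball_pi _ hε]
    simp only [Real.ball_eq_Ioo]
  have hsub : e.symm '' ball (e p) ε ⊆ U := by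
    rintro _ ⟨v, hv, rfl⟩
    obtain ⟨q, hq, rfl⟩ := hball hv
    rwa [e.left_inv (hUe hq)]
  refine ⟨e.symm '' ball (e p) ε, Or.inr ⟨_, _, fun i => ?_, ?_, by rw [hpi]⟩,
    ⟨e p, mem_ball_self hε, e.left_inv (hUe hp)⟩, hsub⟩
  · linarith
  · rw [← hpi]
    rintro v hv
    obtain ⟨q, hq, rfl⟩ := hball hv
    exact e.map_source (hUe hq)

variable [T2Space X] [LocallyCompactSpace X]

lemma isCell_of_mem_chartBoxes {B : Set X} (hB : B ∈ chartBoxes e) (hne : B.Nonempty) :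
    IsCell n B := by
  rcases hB with rfl | ⟨a, b, h, hB, rfl⟩
  · exact absurd hne not_nonempty_empty
  · exact (isCell_pi_Ioo a b h).image hB

lemma exists_isCell
    (hchart : ∀ p : X, ∃ e : OpenPartialHomeomorph X (Fin n → ℝ), p ∈ e.source)
    (p : X) (U : Set X) (hU : IsOpen U) (hp : p ∈ U) :
    ∃ V, IsCell n V ∧ p ∈ V ∧ V ⊆ U := by
  obtain ⟨e, he⟩ := hchart p
  obtain ⟨B, hB, hpB, hBU⟩ := exists_mem_chartBoxes (hU.inter e.open_source) inter_subset_right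
    ⟨hp, he⟩
  exact ⟨B, isCell_of_mem_chartBoxes hB ⟨p, hpB⟩, hpB, hBU.trans inter_subset_left⟩

lemma exists_isLocalGenerator
    (hchart : ∀ p : X, ∃ e : OpenPartialHomeomorph X (Fin n → ℝ), p ∈ e.source) :
    ∃ g : X → Cochain X, IsLocalGenerator n g := by
  have h : ∀ p : X, ∃ g : Cochain X, g ∈ cocycles (n + 1) {p} ∧
      ∃ U, IsCell n U ∧ p ∈ U ∧ g ∉ coboundaries n U := fun p => by
    obtain ⟨V, hV, hp, -⟩ := exists_isCell hchart p univ isOpen_univ (mem_univ p)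
    obtain ⟨g, hg, hgV, -⟩ := hV.exists_generator p hp
    exact ⟨g, hg, V, hV, hp, hgV⟩
  choose g hg using h
  exact ⟨g, hg⟩

lemma IsLocalGenerator.isGenerated
    (hchart : ∀ p : X, ∃ e : OpenPartialHomeomorph X (Fin n → ℝ), p ∈ e.source)
    {g : X → Cochain X} (hg : IsLocalGenerator n g) {U : Set X}
    (hU : IsOpen U) : IsGenerated n g U := by
  have hcell := exists_isCell hchart
  have hbox : ∀ e : OpenPartialHomeomorph X (Fin n → ℝ), ∀ B ∈ chartBoxes e,
      IsOpen B ∧ IsGenerated n g B := fun e B hB => by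
    by_cases hne : B.Nonempty
    · have := isCell_of_mem_chartBoxes hB hne
      exact ⟨this.isOpen, this.isGenerated hg hcell⟩
    · rw [not_nonempty_iff_eq_empty.1 hne]
      exact ⟨isOpen_empty, isGenerated_empty⟩
  refine isGenerated_of_basis (𝓑 := {V | IsOpen V ∧
    ∃ e : OpenPartialHomeomorph X (Fin n → ℝ), V ⊆ e.source}) (fun B hB => hB.1)
    (fun B hB C hC => ⟨hB.1.inter hC.1, hB.2.imp fun e he => inter_subset_left.trans he⟩)
    ?_ fun p hp => ?_
  · rintro B ⟨hB, e, he⟩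
    exact isGenerated_of_basis (fun C hC => (hbox e C hC).1)
      (fun C hC D hD => inter_mem_chartBoxes hC hD) (fun C hC => (hbox e C hC).2)
      fun p hp => exists_mem_chartBoxes hB he hp
  · obtain ⟨e, he⟩ := hchart p
    exact ⟨U ∩ e.source, ⟨hU.inter e.open_source, e, inter_subset_right⟩, ⟨hp, he⟩,
      inter_subset_left⟩

/-- Cocycles supported at the points of a closed manifold, representing the generator of its
top-degree cohomology. -/
theorem exists_point_cocycles [CompactSpace X]
    (hchart : ∀ p : X, ∃ e : OpenPartialHomeomorph X (Fin n → ℝ), p ∈ e.source) :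
    ∃ g : X → Cochain X, (∀ p, g p ∈ cocycles (n + 1) {p}) ∧ (∀ p, g p ∉ coboundaries n univ) ∧
      ∀ W, IsOpen W → IsPreconnected W → ∀ p ∈ W, ∀ q ∈ W, g p + g q ∈ coboundaries n W := by
  obtain ⟨g, hg⟩ := exists_isLocalGenerator hchart
  have hcell := exists_isCell hchart
  refine ⟨g, fun p => (hg p).1, fun p hp => ?_, fun W hW hWc p hp q hq => ?_⟩
  · obtain ⟨L, hL, hLuniv, -⟩ := exists_list_of_isCompact (𝓑 := {V : Set X | IsCell n V})
      (fun B hB => hB.isOpen) (fun p _ => hcell p univ isOpen_univ (mem_univ p)) isCompact_univ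
      Subset.rfl
    have heven := isEven_listUnion (fun p => (hg p).1) (fun U hU => hg.isGenerated hchart hU) L
      (fun B hB => (hL B hB).isOpen) fun B hB => IsCell.isEven hg hcell (hL B hB)
    rw [univ_subset_iff.1 hLuniv] at heven
    have := heven (Finsupp.single p 1) (Finsupp.single_mem_supported _ _ (mem_univ p)) (by simpa)
    simp at this
  · refine hWc.induction₂ (fun p q => g p + g q ∈ coboundaries n W) (fun p hp => ?_)
      (fun p q r _ _ _ h h' => ?_) (fun p q _ _ h => by rwa [add_comm]) hp hq
    · obtain ⟨V, hV, hpV, hVW⟩ := hcell p W hW hp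
      filter_upwards [mem_nhdsWithin_of_mem_nhds (hV.isOpen.mem_nhds hpV)] with q hq
      exact coboundaries_mono hVW (hV.add_mem_coboundaries hg hcell hpV hq)
    · exact add_mem_of_add_mem h (by rwa [add_comm])

end Manifold

section Separation

lemma exists_retraction [MetricSpace X] {S : Set X} (hS : IsCompact S) (hne : S.Nonempty) :
    ∃ ρ : X → S, ∀ p : S, ρ p = p ∧ ContinuousAt ρ p := by
  choose f hfS hf using fun q : X => hS.exists_infDist_eq_dist hne q
  have hle : ∀ q, ∀ p ∈ S, dist (f q) p ≤ 2 * dist q p := fun q p hp => by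
    have h1 := hf q ▸ infDist_le_dist_of_mem (x := q) hp
    have h2 := dist_triangle_left (f q) p q
    linarith
  have hfp : ∀ p : S, f p = p := fun p => dist_le_zero.1 (by simpa using hle p p p.2)
  refine ⟨fun q => ⟨f q, hfS q⟩, fun p => ⟨Subtype.ext (hfp p), ?_⟩⟩
  refine Metric.continuousAt_iff.2 fun ε hε => ⟨ε / 2, half_pos hε, fun q hq => ?_⟩
  rw [Subtype.dist_eq]
  simp only [hfp]
  linarith [hle q p p.2]

lemma exists_locZero_on [MetricSpace X] {S : Set X} (hS : IsCompact S) {m : ℕ}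
    {η : Cochain X} (hη : HasLen (m + 1) η) (hd : ∀ p ∈ S, LocZero (d η) p) {ζ : Cochain S}
    (hζ : HasLen m ζ) (h : ∀ p, LocZero (pull (fun s : S => (s : X)) η + d ζ) p) :
    ∃ η', HasLen (m + 1) η' ∧ d η' = d η ∧ ∀ p ∈ S, LocZero η' p := by
  rcases S.eq_empty_or_nonempty with rfl | hne
  · exact ⟨η, hη, rfl, fun p hp => hp.elim⟩
  obtain ⟨ρ, hρ⟩ := exists_retraction hS hne
  have hβ : HasLen m (prismFun id (fun q => (ρ q : X)) η + pull ρ ζ) :=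
    (hη.prismFun _ _).add (hζ.pull ρ)
  refine ⟨η + d (prismFun id (fun q => (ρ q : X)) η + pull ρ ζ), hη.add hβ.d, ?_, fun p hp => ?_⟩
  · rw [map_add, d_d, add_zero]
  obtain ⟨hρp, hρc⟩ := hρ ⟨p, hp⟩
  have h1 : LocZero (prismFun id (fun q => (ρ q : X)) (d η)) p :=
    locZero_prismFun continuousAt_id (continuous_subtype_val.continuousAt.comp hρc)
      (congrArg Subtype.val hρp).symm (hd p hp)
  have h2 : LocZero (pull ρ (pull (fun s : S => (s : X)) η + d ζ)) p :=
    LocZero.pull hρc (h _)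
  have key : η + d (prismFun id (fun q => (ρ q : X)) η + pull ρ ζ) =
      prismFun id (fun q => (ρ q : X)) (d η) + pull ρ (pull (fun s : S => (s : X)) η + d ζ) := by
    ext l
    have h3 := d_prismFun id (fun q => (ρ q : X)) η l
    rw [map_add, map_add, d_pull]
    simp only [Pi.add_apply, pull_apply, List.map_map, List.map_id] at h3 ⊢
    have h4 : d (prismFun id (fun q => (ρ q : X)) η) l =
        prismFun id (fun q => (ρ q : X)) (d η) l + (η l + η (l.map fun q => (ρ q : X))) := by
      rw [← h3, add_comm, add_assoc, ZModModule.add_self, add_zero]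
    rw [h4]
    change _ = _ + (η (l.map fun q => (ρ q : X)) + _)
    linear_combination ZModModule.add_self (η l)
  rw [key]
  exact h1.add h2

lemma mem_coboundaries_of_separates [TopologicalSpace X] [CompactSpace X] [LocallyConnectedSpace X]
    {n : ℕ} {S : Set X} (hS : IsClosed S) {x y : X} (hx : x ∈ Sᶜ)
    (hsep : connectedComponentIn Sᶜ x ≠ connectedComponentIn Sᶜ y) {ωx ωy η : Cochain X}
    (hωx : ∀ p, p ≠ x → LocZero ωx p) (hωy : ∀ p, p ≠ y → LocZero ωy p) (hη : HasLen n η)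
    (h : ∀ p, LocZero (ωx + ωy + d η) p) (hηS : ∀ p ∈ S, LocZero η p) :
    ωx ∈ coboundaries n univ := by
  classical
  set U := connectedComponentIn Sᶜ x with hU
  have hUo : IsOpen U := hS.isOpen_compl.connectedComponentIn
  have hxU : x ∈ U := mem_connectedComponentIn hx
  have hUS : U ⊆ Sᶜ := connectedComponentIn_subset _ _
  have hyU : y ∉ U := fun hy => hsep (connectedComponentIn_eq hy)
  set a : X → ZMod 2 := U.indicator 1 with ha
  refine ⟨mulHead a η, hη.mulHead a, ⟨univ, isCompact_univ, Subset.rfl, fun p hp => (hp trivial).elim⟩,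
    fun p => ?_⟩
  rw [d_mulHead a hη.nil]
  by_cases hpS : p ∈ S
  · exact (hωx p fun e => hx (e ▸ hpS)).add
      (((hηS p hpS).cupD a).add ((hηS p hpS).d.mulHead a))
  by_cases hpU : p ∈ U
  · have hap : ∀ᶠ q in 𝓝 p, a q = 1 := by
      filter_upwards [hUo.mem_nhds hpU] with q hq
      simp [ha, hq]
    have h1 := locZero_mulHead_add_self (ω := d η) (d_nil η) hap
    have h2 : LocZero (ωx + d η) p := by
      refine LocZero.of_add (ω := ωy) ?_ (hωy p fun e => hyU (e ▸ hpU))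
      convert h p using 1
      abel
    have h3 := (locZero_cupD_of_const (ω := η) hap).add (h2.trans (by rwa [add_comm] at h1))
    convert h3 using 1
    abel
  · have hap : ∀ᶠ q in 𝓝 p, a q = 0 := by
      filter_upwards [hS.isOpen_compl.connectedComponentIn.mem_nhds
        (mem_connectedComponentIn (F := Sᶜ) hpS)] with q hq
      have hqU : q ∉ U := fun hqU => hpU (by
        rw [hU, connectedComponentIn_eq hqU, ← connectedComponentIn_eq hq]
        exact mem_connectedComponentIn hpS)
      simp [ha, hqU]
    exact (hωx p fun e => hpU (e ▸ hxU)).add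
      ((locZero_cupD_of_const hap).add (locZero_mulHead_of_eq_zero hap))

end Separation

lemma exists_chart_of_isTopManifold [TopologicalSpace X] {n : ℕ} (hX : IsTopManifold n X) (p : X) :
    ∃ e : OpenPartialHomeomorph X (Fin n → ℝ), p ∈ e.source := by
  obtain ⟨U, V, hU, hp, hV, ⟨φ⟩⟩ := hX p
  have : Nonempty U := ⟨⟨p, hp⟩⟩
  have : Nonempty V := ⟨φ ⟨p, hp⟩⟩
  refine ⟨((hU.isOpenEmbedding_subtypeVal.toOpenPartialHomeomorph _).symm.trans
    (φ.toOpenPartialHomeomorph.trans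
      (hV.isOpenEmbedding_subtypeVal.toOpenPartialHomeomorph _))).trans
    (EuclideanSpace.equiv (Fin n) ℝ).toHomeomorph.toOpenPartialHomeomorph, ?_⟩
  simp [hp]

end AlexanderSpanier

open AlexanderSpanier Set Topology

/-- **Part of Lemma 2.1.** Let `M` be a compact, connected, Hausdorff topological
`n`-manifold, `S ⊆ M` closed, and `x, y ∈ M \ S` in different connected components of
`M \ S`. If `h : S → M` is continuous and homotopic to the inclusion `S ↪ M` through maps
whose images avoid `{x, y}`, then `h(S)` is closed, avoids `x` and `y`, and separates
`x` from `y`. -/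
theorem image_separates (n : ℕ) (M : Type) [TopologicalSpace M] [CompactSpace M]
    [ConnectedSpace M] [T2Space M] (hM : IsTopManifold n M)
    (S : Set M) (hS : IsClosed S) (x y : M) (hx : x ∈ Sᶜ) (hy : y ∈ Sᶜ)
    (hsep : connectedComponentIn Sᶜ x ≠ connectedComponentIn Sᶜ y)
    (h : S → M) (hh : Continuous h)
    (H : Set.Icc (0:ℝ) 1 × S → M) (hHcont : Continuous H)
    (hH0 : ∀ s : S, H (⟨0, by norm_num⟩, s) = (s : M))
    (hH1 : ∀ s : S, H (⟨1, by norm_num⟩, s) = h s)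
    (hHavoid : ∀ p, H p ≠ x ∧ H p ≠ y) :
    IsClosed (Set.range h) ∧ x ∈ (Set.range h)ᶜ ∧ y ∈ (Set.range h)ᶜ ∧
      connectedComponentIn (Set.range h)ᶜ x ≠ connectedComponentIn (Set.range h)ᶜ y := by
  have hScpt : CompactSpace S := isCompact_iff_compactSpace.1 hS.isCompact
  have hcl : IsClosed (Set.range h) := (isCompact_range hh).isClosed
  have hxr : x ∈ (Set.range h)ᶜ := by
    rintro ⟨s, hs⟩
    exact (hHavoid _).1 ((hH1 s).trans hs)
  have hyr : y ∈ (Set.range h)ᶜ := by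
    rintro ⟨s, hs⟩
    exact (hHavoid _).2 ((hH1 s).trans hs)
  refine ⟨hcl, hxr, hyr, fun heq => ?_⟩
  have hchart := exists_chart_of_isTopManifold hM
  choose e he using hchart
  let _ : ChartedSpace (Fin n → ℝ) M :=
    { atlas := Set.range e, chartAt := e, mem_chart_source := he,
      chart_mem_atlas := fun p => ⟨p, rfl⟩ }
  have := ChartedSpace.locallyConnectedSpace (Fin n → ℝ) M
  have := ChartedSpace.secondCountable_of_sigmaCompact (Fin n → ℝ) M
  let _ := TopologicalSpace.metrizableSpaceMetric M
  obtain ⟨g, hg, hgn, hgW⟩ := exists_point_cocycles fun p => ⟨e p, he p⟩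
  have hg0 : ∀ p q, q ≠ p → LocZero (g p) q := fun p q hqp => by
    obtain ⟨-, -, K, -, hK, h0⟩ := hg p
    exact h0 q fun hq => hqp (hK hq)
  obtain ⟨η, hη, ⟨K, -, hKW, hK⟩, hηd⟩ := hgW _ (hcl.isOpen_compl.connectedComponentIn (x := x))
    isPreconnected_connectedComponentIn x (mem_connectedComponentIn hxr) y
    (heq ▸ mem_connectedComponentIn hyr)
  have hdη : ∀ p, p ≠ x → p ≠ y → LocZero (d η) p := fun p h1 h2 =>
    (hηd p).of_add ((hg0 x p h1).add (hg0 y p h2))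
  obtain ⟨η', hη', hdη', hη'S⟩ : ∃ η', HasLen n η' ∧ d η' = d η ∧ ∀ p ∈ S, LocZero η' p := by
    rcases n with _ | m
    · refine ⟨η, hη, rfl, fun p _ => ⟨univ, Filter.univ_mem, fun l _ => ?_⟩⟩
      by_contra hl
      exact (hη l hl).1 (List.length_eq_zero_iff.1 (hη l hl).2)
    obtain ⟨ζ, hζ, hζd, -⟩ := exists_homotopy hHcont (L := univ) isCompact_univ
      (O := univ) isOpen_univ hη (fun t p _ => hdη _ (hHavoid (t, p)).1 (hHavoid (t, p)).2)
      (fun t p _ hp => (hp trivial).elim) ⟨0, by norm_num⟩ ⟨1, by norm_num⟩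
    simp only [hH0, hH1] at hζd
    refine exists_locZero_on hS.isCompact hη (fun p hp => hdη p (fun e => hx (e ▸ hp))
      fun e => hy (e ▸ hp)) hζ fun p => LocZero.of_add (ω := pull (fun q => h q) η) ?_
      (LocZero.pull hh.continuousAt (hK _ fun hp =>
        connectedComponentIn_subset _ _ (hKW hp) ⟨p, rfl⟩))
    convert hζd p trivial using 1
    abel
  exact hgn x (mem_coboundaries_of_separates hS hx hsep (hg0 x) (hg0 y) hη'
    (fun p => by rw [hdη']; exact hηd p) hη'S)
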